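/- Let (A, φ) be a C*-probability space with faithful tracial φ. Let (X_i)_{i∈ℕ} be free self-adjoint elements of A with φ(X_i) = 0 and φ(X_i²) = σ_i² for all i. Fix n with B_n² := ∑_{i=1}^n σ_i² > 0 and suppose L_{S,4n} < 1/16. Then V_n² := ∑_{i=1}^n X_i² is invertible in A, so U_n := V_n^{−1/2} S_n V_n^{−1/2} (with S_n := ∑_{i=1}^n X_i) is well-defined in A and self-adjoint. Moreover, there is an absolute constant C > 0 such that whenever additionally L_{S,3n} < 1/(2e), the analytic distribution μ_n of U_n satisfies Δ(μ_n, ω) ≤ C·max{ |log L_{S,3n}|·L_{S,3n} , |log L_{S,4n}|·L_{S,4n}^{1/2} }. -/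

import Mathlib

open MeasureTheory Filter Topology

noncomputable section

/-- Wigner's semicircle law: density `(2π)⁻¹ √(4 - t²)` on `[-2, 2]`. -/
def semicircleLaw : Measure ℝ :=
  volume.withDensity fun t =>
    ENNReal.ofReal (Set.indicator (Set.Icc (-2 : ℝ) 2)
      (fun t => (2 * Real.pi)⁻¹ * Real.sqrt (4 - t ^ 2)) t)

/-- Distribution function of a measure on `ℝ`. -/
def cdf (μ : Measure ℝ) (x : ℝ) : ℝ := (μ (Set.Iic x)).toReal

/-- Kolmogorov distance. -/
def kolDist (μ ν : Measure ℝ) : ℝ := ⨆ x : ℝ, |cdf μ x - cdf ν x|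

/-- Cauchy transform. -/
def cauchyG (μ : Measure ℝ) (z : ℂ) : ℂ := ∫ t, (z - (t : ℂ))⁻¹ ∂μ

/-- Support of a measure on `ℝ`. -/
def msupport (μ : Measure ℝ) : Set ℝ :=
  {x : ℝ | ∀ U : Set ℝ, IsOpen U → x ∈ U → 0 < μ U}

variable {A : Type*}

/-- `φ` is a state: unital and positive. -/
def IsState [Ring A] [StarRing A] [Algebra ℂ A] (φ : A →ₗ[ℂ] ℂ) : Prop :=
  φ 1 = 1 ∧ ∀ x : A, 0 ≤ (φ (star x * x)).re ∧ (φ (star x * x)).im = 0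

/-- `φ` is tracial. -/
def IsTracial [Ring A] [Algebra ℂ A] (φ : A →ₗ[ℂ] ℂ) : Prop :=
  ∀ x y : A, φ (x * y) = φ (y * x)

/-- `φ` is faithful. -/
def IsFaithful [Ring A] [StarRing A] [Algebra ℂ A] (φ : A →ₗ[ℂ] ℂ) : Prop :=
  ∀ x : A, φ (star x * x) = 0 → x = 0

/-- Freeness of a family of unital subalgebras w.r.t. `φ`. -/
def IsFreeFamily [Ring A] [Algebra ℂ A] (φ : A →ₗ[ℂ] ℂ)
    {I : Type*} (S : I → Subalgebra ℂ A) : Prop :=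
  ∀ (k : ℕ) (idx : Fin (k + 1) → I),
    (∀ j : Fin k, idx j.castSucc ≠ idx j.succ) →
    ∀ x : Fin (k + 1) → A, (∀ j, x j ∈ S (idx j)) → (∀ j, φ (x j) = 0) →
      φ (List.ofFn x).prod = 0

/-- Freeness of a family of elements: the generated unital subalgebras are free. -/
def AreFree [Ring A] [Algebra ℂ A] (φ : A →ₗ[ℂ] ℂ) {I : Type*} (X : I → A) : Prop :=
  IsFreeFamily φ fun i => Algebra.adjoin ℂ {X i}

/-- `μ` is the analytic distribution of `x`: a probability measure whose moments are the
`φ`-moments of `x`. -/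
def IsDistribution [Ring A] [Algebra ℂ A] (φ : A →ₗ[ℂ] ℂ) (x : A) (μ : Measure ℝ) : Prop :=
  IsProbabilityMeasure μ ∧ ∀ k : ℕ, φ (x ^ k) = ((∫ t, t ^ k ∂μ : ℝ) : ℂ)

/-- The Lyapunov-type fraction `L_{S,kn} = (∑_{i<n} ‖X i‖ ^ k) / B_n ^ k`. -/
def Lsn [Norm A] (X : ℕ → A) (σ : ℕ → ℝ) (k n : ℕ) : ℝ :=
  (∑ i ∈ Finset.range n, ‖X i‖ ^ k) /
    Real.sqrt (∑ i ∈ Finset.range n, σ i ^ 2) ^ k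

/-- `s` is a standard semicircular element. -/
def IsStdSemicircular [Ring A] [StarRing A] [Algebra ℂ A] (φ : A →ₗ[ℂ] ℂ) (s : A) : Prop :=
  IsSelfAdjoint s ∧ ∀ k : ℕ, φ (s ^ k) = ((∫ t, t ^ k ∂semicircleLaw : ℝ) : ℂ)

end

section Semicircle

open Real in
lemma integral_semicircle_density :
    ∫ t in (-2 : ℝ)..2, (2 * π)⁻¹ * √(4 - t ^ 2) = 1 := by
  have h := intervalIntegral.integral_comp_mul_left (a := -1) (b := 1)
    (fun t : ℝ => √(4 - t ^ 2)) (two_ne_zero (α := ℝ))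
  have h2 : ∀ x : ℝ, √(4 - (2 * x) ^ 2) = 2 * √(1 - x ^ 2) := fun x => by
    rw [show 4 - (2 * x) ^ 2 = 2 ^ 2 * (1 - x ^ 2) by ring, sqrt_mul (by positivity),
      sqrt_sq (by norm_num)]
  simp only [h2, intervalIntegral.integral_const_mul, integral_sqrt_one_sub_sq] at h
  norm_num at h
  rw [intervalIntegral.integral_const_mul, ← mul_right_inj' (two_ne_zero (α := ℝ))]
  have := pi_pos
  field_simp
  linarith

lemma measurable_semicircle_density : Measurable fun t : ℝ =>
    Set.indicator (Set.Icc (-2 : ℝ) 2)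
      (fun t => (2 * Real.pi)⁻¹ * Real.sqrt (4 - t ^ 2)) t :=
  (by fun_prop : Measurable fun t : ℝ => (2 * Real.pi)⁻¹ * Real.sqrt (4 - t ^ 2)).indicator
    measurableSet_Icc

lemma semicircle_density_nonneg (t : ℝ) : 0 ≤ Set.indicator (Set.Icc (-2 : ℝ) 2)
      (fun t => (2 * Real.pi)⁻¹ * Real.sqrt (4 - t ^ 2)) t :=
  Set.indicator_nonneg (fun _ _ => by positivity) _

lemma integral_semicircleLaw {E : Type*} [NormedAddCommGroup E] [NormedSpace ℝ E]
    (f : ℝ → E) : ∫ t, f t ∂semicircleLaw =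
      ∫ t in (-2 : ℝ)..2, ((2 * Real.pi)⁻¹ * Real.sqrt (4 - t ^ 2)) • f t := by
  rw [semicircleLaw, integral_withDensity_eq_integral_toReal_smul
    measurable_semicircle_density.ennreal_ofReal (by simp),
    intervalIntegral.integral_of_le (by norm_num), ← integral_Icc_eq_integral_Ioc,
    ← integral_indicator measurableSet_Icc]
  congr 1
  ext t
  rw [ENNReal.toReal_ofReal (semicircle_density_nonneg t)]
  by_cases ht : t ∈ Set.Icc (-2 : ℝ) 2 <;> simp [ht]

instance : IsProbabilityMeasure semicircleLaw where
  measure_univ := by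
    have hc : Continuous fun t : ℝ => (2 * Real.pi)⁻¹ * Real.sqrt (4 - t ^ 2) := by fun_prop
    rw [semicircleLaw, withDensity_apply _ MeasurableSet.univ, Measure.restrict_univ,
      ← ofReal_integral_eq_lintegral_ofReal _ (ae_of_all _ semicircle_density_nonneg),
      integral_indicator measurableSet_Icc, integral_Icc_eq_integral_Ioc,
      ← intervalIntegral.integral_of_le (by norm_num), integral_semicircle_density]
    · simp
    · rw [integrable_indicator_iff measurableSet_Icc]
      exact hc.continuousOn.integrableOn_Icc

lemma semicircleLaw_compl_Icc : semicircleLaw (Set.Icc (-2) 2)ᶜ = 0 := by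
  rw [semicircleLaw, withDensity_apply _ measurableSet_Icc.compl, lintegral_eq_zero_iff
    measurable_semicircle_density.ennreal_ofReal]
  filter_upwards [self_mem_ae_restrict (μ := volume) (measurableSet_Icc (a := (-2:ℝ)) (b := 2)).compl]
    with t ht
  simp [Set.indicator_of_notMem ht]

lemma cdf_semicircleLaw_sub_le {x y : ℝ} (hxy : x ≤ y) :
    cdf semicircleLaw y - cdf semicircleLaw x ≤ y - x := by
  have h1 : semicircleLaw (Set.Iic y) ≤ semicircleLaw (Set.Iic x) + semicircleLaw (Set.Ioc x y) := by
    rw [← Set.Iic_union_Ioc_eq_Iic hxy]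
    exact measure_union_le _ _
  have h2 : semicircleLaw (Set.Ioc x y) ≤ ENNReal.ofReal (y - x) := by
    rw [semicircleLaw, withDensity_apply _ measurableSet_Ioc]
    calc _ ≤ ∫⁻ _ in Set.Ioc x y, 1 := by
          refine lintegral_mono fun t => ?_
          rw [← ENNReal.ofReal_one]
          refine ENNReal.ofReal_le_ofReal ?_
          refine Set.indicator_le' (fun t ht => ?_) (fun _ _ => zero_le_one) t
          have h3 : √(4 - t ^ 2) ≤ 2 := by
            rw [Real.sqrt_le_left (by norm_num)]; nlinarith [sq_nonneg t]
          have := Real.pi_gt_three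
          change (2 * Real.pi)⁻¹ * √(4 - t ^ 2) ≤ 1
          rw [inv_mul_le_iff₀ (by positivity)]
          linarith
      _ = _ := by simp
  have h3 := h1.trans (add_le_add_right h2 _)
  have h4 := ENNReal.toReal_mono (by simp) h3
  rw [ENNReal.toReal_add (by simp) (by simp), ENNReal.toReal_ofReal (by linarith)] at h4
  unfold cdf
  linarith

/-- The Joukowski map `g ↦ g + g⁻¹` sends the punctured unit disc onto `ℂ \ [-2, 2]`. -/
lemma exists_add_inv_eq {z : ℂ} (hz : z.im ≠ 0) :
    ∃ g : ℂ, g ≠ 0 ∧ ‖g‖ < 1 ∧ g + g⁻¹ = z := by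
  obtain ⟨w, hw⟩ := IsAlgClosed.exists_pow_nat_eq (z ^ 2 - 4) (n := 2) (by norm_num)
  have key : ∀ g g' : ℂ, g * g' = 1 → g + g' = z → ‖g‖ < 1 →
      ∃ g : ℂ, g ≠ 0 ∧ ‖g‖ < 1 ∧ g + g⁻¹ = z := fun g g' h1 h2 h3 =>
    ⟨g, left_ne_zero_of_mul_eq_one h1, h3, by rw [← eq_inv_of_mul_eq_one_right h1, h2]⟩
  have h1 : (z - w) / 2 * ((z + w) / 2) = 1 := by linear_combination (-1 / 4) * hw
  have h2 : (z - w) / 2 + (z + w) / 2 = z := by ring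
  generalize (z - w) / 2 = g at h1 h2
  generalize (z + w) / 2 = g' at h1 h2
  rcases lt_trichotomy ‖g‖ 1 with h | h | h
  · exact key g g' h1 h2 h
  · exfalso
    have h3 : g' = (starRingEnd ℂ) g := by
      rw [eq_inv_of_mul_eq_one_right h1, Complex.inv_def, Complex.normSq_eq_norm_sq, h]
      simp
    apply hz
    rw [← h2, h3]
    simp
  · refine key g' g (by rwa [mul_comm]) (by rwa [add_comm]) ?_
    have := congrArg norm h1
    rw [norm_mul, norm_one] at this
    by_contra! h'
    nlinarith

open Complex in
lemma integral_inv_one_sub_mul_exp {g : ℂ} (hg : ‖g‖ < 1) :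
    ∫ θ in (-Real.pi)..Real.pi, (1 - g * exp (θ * I))⁻¹ = 2 * Real.pi := by
  have h1 : ∀ ζ : ℂ, ‖ζ‖ ≤ 1 → 1 - g * ζ ≠ 0 := fun ζ hζ h => by
    have := congrArg norm (sub_eq_zero.1 h)
    rw [norm_one, norm_mul] at this
    nlinarith [norm_nonneg g]
  have h2 : DiffContOnCl ℂ (fun ζ : ℂ => (1 - g * ζ)⁻¹) (Metric.ball 0 |1|) := by
    apply DifferentiableOn.diffContOnCl
    intro ζ hζ
    refine DifferentiableAt.differentiableWithinAt ?_
    refine DifferentiableAt.inv (by fun_prop) (h1 ζ ?_)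
    simpa [closure_ball] using hζ
  have h3 := h2.circleAverage
  rw [Real.circleAverage_def] at h3
  simp only [circleMap, ofReal_one, one_mul, zero_add, mul_zero, sub_zero, inv_one] at h3
  have h4 : Function.Periodic (fun θ : ℝ => (1 - g * exp (θ * I))⁻¹) (2 * Real.pi) := fun θ => by
    have : exp (((θ + 2 * Real.pi : ℝ) : ℂ) * I) = exp (θ * I) := by
      rw [ofReal_add, add_mul, exp_add]; simp
    simp only [this]
  have h5 := h4.intervalIntegral_add_eq (-Real.pi) 0
  rw [show -Real.pi + 2 * Real.pi = Real.pi by ring, zero_add] at h5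
  rw [h5]
  have hpi : (Real.pi : ℂ) ≠ 0 := by exact_mod_cast Real.pi_ne_zero
  rw [real_smul] at h3
  push_cast at h3
  rw [inv_mul_eq_one₀ (by simp [hpi])] at h3
  exact h3.symm

open Complex in
lemma cauchyG_semicircleLaw {g z : ℂ} (hz : z.im ≠ 0) (hg0 : g ≠ 0) (hg : ‖g‖ < 1)
    (hgz : g + g⁻¹ = z) : cauchyG semicircleLaw z = g := by
  have hne : ∀ t : ℝ, z - t ≠ 0 := fun t h => hz (by
    rw [sub_eq_zero.1 h]; simp)
  have hpi : (Real.pi : ℂ) ≠ 0 := by exact_mod_cast Real.pi_ne_zero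
  have hexp : ∀ θ : ℝ, 1 - g * exp (θ * I) ≠ 0 := fun θ h => by
    have := congrArg norm (sub_eq_zero.1 h)
    rw [norm_one, norm_mul, norm_exp_ofReal_mul_I] at this
    linarith
  have hcont : Continuous fun θ : ℝ => (1 - g * exp (θ * I))⁻¹ :=
    Continuous.inv₀ (by fun_prop) hexp
  have hcont' : Continuous fun θ : ℝ => (1 - g * exp ((-θ : ℝ) * I))⁻¹ :=
    hcont.comp continuous_neg
  have hg2 : 1 - g ^ 2 ≠ 0 := fun h => by
    have := congrArg norm (sub_eq_zero.1 h)
    rw [norm_one, norm_pow] at this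
    nlinarith [norm_nonneg g]
  rw [cauchyG, integral_semicircleLaw]
  -- substitute `t = 2 cos θ`
  have hden : Continuous fun t : ℝ =>
      ((2 * Real.pi)⁻¹ * Real.sqrt (4 - t ^ 2)) • (z - (t : ℂ))⁻¹ :=
    (by fun_prop : Continuous fun t : ℝ => (2 * Real.pi)⁻¹ * Real.sqrt (4 - t ^ 2)).smul
      ((continuous_const.sub Complex.continuous_ofReal).inv₀ hne)
  have hsub := intervalIntegral.integral_deriv_smul_comp (a := Real.pi) (b := 0)
    (f := fun θ => 2 * Real.cos θ) (f' := fun θ => -(2 * Real.sin θ))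
    (g := fun t : ℝ => ((2 * Real.pi)⁻¹ * Real.sqrt (4 - t ^ 2)) • (z - (t : ℂ))⁻¹)
    (fun θ _ => by simpa using (Real.hasDerivAt_cos θ).const_mul 2)
    (Continuous.continuousOn (by fun_prop)) hden
  simp only [Real.cos_pi, Real.cos_zero, mul_neg, mul_one] at hsub
  rw [← hsub, intervalIntegral.integral_symm, ← intervalIntegral.integral_neg]
  have heq : Set.EqOn (fun θ : ℝ => -(-(2 * Real.sin θ) •
      ((fun t : ℝ => ((2 * Real.pi)⁻¹ * Real.sqrt (4 - t ^ 2)) • (z - (t : ℂ))⁻¹) ∘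
        fun θ => 2 * Real.cos θ) θ))
      (fun θ : ℝ => (2 * Real.pi : ℂ)⁻¹ * ((z + 2 * Real.cos θ) - (1 - g ^ 2) / g *
        ((1 - g * exp (θ * I))⁻¹ + (1 - g * exp ((-θ : ℝ) * I))⁻¹ - 1))) (Set.uIcc 0 Real.pi) := by
    intro θ hθ
    rw [Set.uIcc_of_le Real.pi_pos.le] at hθ
    have hs : Real.sqrt (4 - (2 * Real.cos θ) ^ 2) = 2 * Real.sin θ := by
      rw [show 4 - (2 * Real.cos θ) ^ 2 = (2 * Real.sin θ) ^ 2 by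
        have := Real.sin_sq_add_cos_sq θ; linear_combination (-4) * this]
      exact Real.sqrt_sq (by have := Real.sin_nonneg_of_mem_Icc hθ; linarith)
    have h1 := hexp θ
    have h2 := hexp (-θ)
    have h3 := hne (2 * Real.cos θ)
    have h5 : exp (θ * I) * exp ((-θ : ℝ) * I) = 1 := by
      rw [← exp_add]; simp
    have h6 : exp (θ * I) + exp ((-θ : ℝ) * I) = 2 * Real.cos θ := by
      rw [exp_mul_I, exp_mul_I]; push_cast; rw [Complex.cos_neg, Complex.sin_neg]; ring
    have h4 : (Real.sin θ : ℂ) ^ 2 = 1 - (Real.cos θ : ℂ) ^ 2 := by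
      push_cast; rw [Complex.sin_sq]
    simp only [Function.comp_apply, hs, real_smul]
    push_cast at h3 h4 h5 h6 ⊢
    have h2' : 1 - g * exp (-θ * I) ≠ 0 := by simpa using h2
    generalize exp (θ * I) = ζ at *
    generalize exp (-θ * I) = ξ at *
    have h7 : z - 2 * Complex.cos θ = (1 - g * ζ) * (1 - g * ξ) / g := by
      rw [← h6, ← hgz]
      field_simp
      linear_combination (-g ^ 2) * h5
    rw [h7]
    have h8 : z + 2 * Complex.cos θ = g + g⁻¹ + (ζ + ξ) := by rw [hgz, h6]
    rw [h8]
    field_simp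
    have h9 : (2 * Complex.cos (θ : ℂ)) ^ 2 = (ζ + ξ) ^ 2 := by rw [h6]
    have h11 : 4 * Complex.sin (θ : ℂ) ^ 2 = 4 - (ζ + ξ) ^ 2 := by
      rw [h4]; linear_combination -h9
    linear_combination g ^ 2 * h11 - g ^ 2 * (2 + g * (ζ + ξ)) * h5
  rw [intervalIntegral.integral_congr heq, intervalIntegral.integral_const_mul]
  have hI : ∫ θ in (0:ℝ)..Real.pi, ((1 - g * exp (θ * I))⁻¹ + (1 - g * exp ((-θ : ℝ) * I))⁻¹) =
      2 * Real.pi := by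
    rw [intervalIntegral.integral_add (hcont.intervalIntegrable _ _)
      (hcont'.intervalIntegrable _ _),
      intervalIntegral.integral_comp_neg (fun θ : ℝ => (1 - g * exp (θ * I))⁻¹), neg_zero, add_comm,
      intervalIntegral.integral_add_adjacent_intervals (hcont.intervalIntegrable _ _)
      (hcont.intervalIntegrable _ _), integral_inv_one_sub_mul_exp hg]
  rw [intervalIntegral.integral_sub (Continuous.intervalIntegrable (by fun_prop) _ _)
    (Continuous.intervalIntegrable (by fun_prop) _ _), intervalIntegral.integral_const_mul,
    intervalIntegral.integral_sub (Continuous.intervalIntegrable (by fun_prop) _ _)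
    (Continuous.intervalIntegrable (by fun_prop) _ _), hI,
    intervalIntegral.integral_add (Continuous.intervalIntegrable (by fun_prop) _ _)
    (Continuous.intervalIntegrable (by fun_prop) _ _), intervalIntegral.integral_const_mul,
    intervalIntegral.integral_ofReal, integral_cos]
  simp only [intervalIntegral.integral_const, real_smul, ← hgz]
  simp
  field_simp
  ring

end Semicircle

section Smoothing

open ProbabilityTheory (cauchyMeasure cauchyPDFReal cauchyPDF)

lemma cdf_nonneg (μ : Measure ℝ) (x : ℝ) : 0 ≤ cdf μ x := ENNReal.toReal_nonneg

lemma cdf_le_one (μ : Measure ℝ) [IsProbabilityMeasure μ] (x : ℝ) : cdf μ x ≤ 1 :=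
  measureReal_le_one (μ := μ)

lemma monotone_cdf (μ : Measure ℝ) [IsProbabilityMeasure μ] : Monotone (cdf μ) := fun _ _ h =>
  measureReal_mono (μ := μ) (Set.Iic_subset_Iic.2 h)

lemma abs_cdf_sub_cdf_le_one (μ ν : Measure ℝ) [IsProbabilityMeasure μ] [IsProbabilityMeasure ν]
    (x : ℝ) : |cdf μ x - cdf ν x| ≤ 1 := by
  rw [abs_sub_le_iff]
  constructor <;>
    linarith [cdf_nonneg μ x, cdf_le_one μ x, cdf_nonneg ν x, cdf_le_one ν x]

lemma abs_cdf_sub_cdf_le_kolDist (μ ν : Measure ℝ) [IsProbabilityMeasure μ]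
    [IsProbabilityMeasure ν] (x : ℝ) : |cdf μ x - cdf ν x| ≤ kolDist μ ν :=
  le_ciSup (f := fun x => |cdf μ x - cdf ν x|)
    ⟨1, by rintro _ ⟨y, rfl⟩; exact abs_cdf_sub_cdf_le_one μ ν y⟩ x

lemma kolDist_le_one (μ ν : Measure ℝ) [IsProbabilityMeasure μ] [IsProbabilityMeasure ν] :
    kolDist μ ν ≤ 1 :=
  ciSup_le (abs_cdf_sub_cdf_le_one μ ν)

lemma cauchyMeasure_real_Iic (s : ℝ) :
    (cauchyMeasure 0 1).real (Set.Iic s) = Real.pi⁻¹ * (Real.arctan s + Real.pi / 2) := by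
  rw [ProbabilityTheory.cauchyMeasure_of_scale_ne_zero 0 one_ne_zero, measureReal_def,
    withDensity_apply _ measurableSet_Iic]
  unfold cauchyPDF
  rw [← integral_eq_lintegral_of_nonneg_ae
    (ae_of_all _ fun x => (ProbabilityTheory.cauchyPDF_pos 0 one_ne_zero x).le) (by fun_prop),
    ← integral_Iic_inv_one_add_sq, ← integral_const_mul]
  congr 1
  ext x
  simp [cauchyPDFReal, add_comm]

lemma cauchyMeasure_real_Ioc {a : ℝ} (ha : 0 ≤ a) :
    (cauchyMeasure 0 1).real (Set.Ioc (-a) a) = 2 / Real.pi * Real.arctan a := by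
  rw [← Set.Iic_sdiff_Iic, measureReal_sdiff (Set.Iic_subset_Iic.2 (by linarith))
    measurableSet_Iic, cauchyMeasure_real_Iic, cauchyMeasure_real_Iic, Real.arctan_neg]
  ring

lemma integrable_arctan_comp (μ : Measure ℝ) [IsProbabilityMeasure μ] {f : ℝ → ℝ}
    (hf : Measurable f) : Integrable (fun t => Real.arctan (f t)) μ := by
  refine Integrable.of_bound (by fun_prop) (Real.pi / 2) (ae_of_all _ fun t => ?_)
  rw [Real.norm_eq_abs, abs_le]
  exact ⟨(Real.neg_pi_div_two_lt_arctan _).le, (Real.arctan_lt_pi_div_two _).le⟩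

/-- Convolving a distribution function with a Cauchy kernel. -/
lemma integral_cdf_cauchyMeasure (μ : Measure ℝ) [IsProbabilityMeasure μ] (x : ℝ) {v : ℝ}
    (hv : 0 < v) : ∫ s, cdf μ (x - v * s) ∂(cauchyMeasure 0 1) =
      Real.pi⁻¹ * ∫ t, Real.arctan ((x - t) / v) ∂μ + 1 / 2 := by
  have hS : MeasurableSet {p : ℝ × ℝ | p.1 + v * p.2 ≤ x} :=
    measurableSet_le (by fun_prop) (by fun_prop)
  have hI : Integrable (Function.uncurry fun t s : ℝ =>
      Set.indicator {p : ℝ × ℝ | p.1 + v * p.2 ≤ x} (1 : ℝ × ℝ → ℝ) (t, s))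
      (μ.prod (cauchyMeasure 0 1)) :=
    (integrable_const (1 : ℝ)).indicator hS
  have h := integral_integral_swap hI
  have h1 : ∀ t : ℝ, (fun s : ℝ => Set.indicator {p : ℝ × ℝ | p.1 + v * p.2 ≤ x}
      (1 : ℝ × ℝ → ℝ) (t, s)) = Set.indicator (Set.Iic ((x - t) / v)) 1 := fun t => by
    ext s
    simp only [Set.indicator, Set.mem_ofPred_eq, Set.mem_Iic, le_div_iff₀ hv, Pi.one_apply]
    congr 1
    rw [eq_iff_iff]
    constructor <;> intro <;> linarith
  have h2 : ∀ s : ℝ, (fun t : ℝ => Set.indicator {p : ℝ × ℝ | p.1 + v * p.2 ≤ x}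
      (1 : ℝ × ℝ → ℝ) (t, s)) = Set.indicator (Set.Iic (x - v * s)) 1 := fun s => by
    ext t
    simp only [Set.indicator, Set.mem_ofPred_eq, Set.mem_Iic, Pi.one_apply]
    congr 1
    rw [eq_iff_iff]
    constructor <;> intro <;> linarith
  simp only [h1, h2, integral_indicator_one measurableSet_Iic, cauchyMeasure_real_Iic] at h
  have h3 : ∀ s, cdf μ (x - v * s) = μ.real (Set.Iic (x - v * s)) := fun _ => rfl
  simp only [h3]
  rw [← h, integral_const_mul, integral_add (integrable_arctan_comp μ (by fun_prop))
    (integrable_const _), integral_const]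
  have := Real.pi_ne_zero
  simp
  field_simp

lemma integrable_cdf_comp (μ c : Measure ℝ) [IsProbabilityMeasure μ] [IsProbabilityMeasure c]
    {f : ℝ → ℝ} (hf : Measurable f) : Integrable (fun s => cdf μ (f s)) c := by
  refine Integrable.of_bound ((monotone_cdf μ).measurable.comp hf).aestronglyMeasurable 1
    (ae_of_all _ fun t => ?_)
  rw [Real.norm_eq_abs, abs_of_nonneg (cdf_nonneg _ _)]
  exact cdf_le_one _ _

/-- If `F_μ - F_ν` is at least `d` on a window of radius `a v` around `x`, then `d` is controlled
by the smoothed difference at `x`. -/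
lemma le_of_window {μ ν : Measure ℝ} [IsProbabilityMeasure μ] [IsProbabilityMeasure ν]
    {v η a d x : ℝ} (hv : 0 < v) (ha0 : 0 ≤ a) (ha : Real.arctan a = 3 * Real.pi / 8)
    (hd : ∀ s ∈ Set.Ioc (-a) a, d ≤ cdf μ (x - v * s) - cdf ν (x - v * s))
    (h : |(∫ t, Real.arctan ((x - t) / v) ∂μ) - ∫ t, Real.arctan ((x - t) / v) ∂ν| ≤ η) :
    3 * d ≤ kolDist μ ν + 2 * η := by
  set c := cauchyMeasure 0 1
  set Δ := kolDist μ ν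
  have h1 : ∫ s, (cdf μ (x - v * s) - cdf ν (x - v * s)) ∂c ≤ Real.pi⁻¹ * η := by
    rw [integral_sub (integrable_cdf_comp μ c (by fun_prop))
      (integrable_cdf_comp ν c (by fun_prop)), integral_cdf_cauchyMeasure μ x hv,
      integral_cdf_cauchyMeasure ν x hv, add_sub_add_right_eq_sub, ← mul_sub]
    exact mul_le_mul_of_nonneg_left ((le_abs_self _).trans h) (by positivity)
  have h2 : ∫ s, (Set.indicator (Set.Ioc (-a) a) (fun _ => d + Δ) s - Δ) ∂c ≤
      ∫ s, (cdf μ (x - v * s) - cdf ν (x - v * s)) ∂c := by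
    refine integral_mono (((integrable_const _).indicator measurableSet_Ioc).sub
      (integrable_const _)) ((integrable_cdf_comp μ c (by fun_prop)).sub
      (integrable_cdf_comp ν c (by fun_prop))) fun s => ?_
    by_cases hs : s ∈ Set.Ioc (-a) a
    · simpa [hs] using hd s hs
    · have := (abs_le.1 (abs_cdf_sub_cdf_le_kolDist μ ν (x - v * s))).1
      simpa [Set.indicator_of_notMem hs] using this
  rw [integral_sub ((integrable_const _).indicator measurableSet_Ioc) (integrable_const _),
    integral_indicator_const _ measurableSet_Ioc, cauchyMeasure_real_Ioc ha0, ha] at h2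
  have hη : 0 ≤ η := (abs_nonneg _).trans h
  have hpi := Real.pi_gt_three
  have h3 : Real.pi⁻¹ * η ≤ 1 / 2 * η := by
    refine mul_le_mul_of_nonneg_right ?_ hη
    rw [inv_le_comm₀ (by positivity) (by norm_num)]
    norm_num; linarith
  have h4 : 2 / Real.pi * (3 * Real.pi / 8) = 3 / 4 := by field_simp; norm_num
  rw [h4] at h2
  simp at h2
  linarith

/-- Esseen-type smoothing inequality with the Cauchy kernel. -/
lemma kolDist_le_of_arctan {μ ν : Measure ℝ} [IsProbabilityMeasure μ] [IsProbabilityMeasure ν]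
    {v η a M : ℝ} (hv : 0 < v) (ha0 : 0 ≤ a) (ha : Real.arctan a = 3 * Real.pi / 8)
    (hη : 0 ≤ η)
    (hlip : ∀ x y, x ≤ y → cdf ν y - cdf ν x ≤ y - x)
    (hsupp : ∀ x, M < |x| → cdf μ x = cdf ν x)
    (h : ∀ x, |x| ≤ M + a * v →
      |(∫ t, Real.arctan ((x - t) / v) ∂μ) - ∫ t, Real.arctan ((x - t) / v) ∂ν| ≤ η) :
    kolDist μ ν ≤ η + 3 * a * v := by
  have hav : 0 ≤ a * v := by positivity
  have hsymm : kolDist ν μ = kolDist μ ν := by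
    unfold kolDist
    simp only [abs_sub_comm]
  have key : ∀ x, |cdf μ x - cdf ν x| ≤ (kolDist μ ν + 2 * η) / 3 + 2 * a * v := by
    intro x
    have hΔ : 0 ≤ kolDist μ ν := (abs_nonneg _).trans (abs_cdf_sub_cdf_le_kolDist μ ν x)
    by_cases hx : M < |x|
    · rw [hsupp x hx, sub_self, abs_zero]
      positivity
    have hx1 := abs_le.1 (not_lt.1 hx)
    rw [abs_le']
    constructor
    · have := le_of_window (μ := μ) (ν := ν) (x := x + a * v)
        (d := cdf μ x - cdf ν x - 2 * a * v) hv ha0 ha ?_ (h _ ?_)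
      · linarith
      · rintro s ⟨hs1, hs2⟩
        have h1 : x ≤ x + a * v - v * s := by nlinarith
        have := monotone_cdf μ h1
        have := hlip _ _ h1
        nlinarith
      · rw [abs_le]; constructor <;> linarith [hx1.1, hx1.2]
    · have := le_of_window (μ := ν) (ν := μ) (x := x - a * v) (η := η)
        (d := cdf ν x - cdf μ x - 2 * a * v) hv ha0 ha ?_ ?_
      · rw [hsymm] at this
        linarith
      · rintro s ⟨hs1, hs2⟩
        have h1 : x - a * v - v * s ≤ x := by nlinarith
        have := monotone_cdf μ h1
        have := hlip _ _ h1
        nlinarith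
      · rw [abs_sub_comm]
        apply h
        rw [abs_le]; constructor <;> linarith [hx1.1, hx1.2]
  have : kolDist μ ν ≤ (kolDist μ ν + 2 * η) / 3 + 2 * a * v := ciSup_le key
  linarith

end Smoothing

section GNS

open scoped ComplexOrder InnerProductSpace

variable {A : Type*} [CStarAlgebra A] [PartialOrder A] [StarOrderedRing A] (f : A →ₚ[ℂ] ℂ)

/-- The `L²`-seminorm `x ↦ f(x⋆ x)^(1/2)` of a positive functional `f`. -/
noncomputable def gnsNorm (x : A) : ℝ := ‖f.toPreGNS x‖

lemma gnsNorm_nonneg (x : A) : 0 ≤ gnsNorm f x := norm_nonneg _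

lemma gnsNorm_sq (x : A) : ((gnsNorm f x ^ 2 : ℝ) : ℂ) = f (star x * x) := by
  have := f.preGNS_norm_sq (f.toPreGNS x)
  simpa [gnsNorm] using this

lemma gnsNorm_add_le (x y : A) : gnsNorm f (x + y) ≤ gnsNorm f x + gnsNorm f y := by
  simpa [gnsNorm] using norm_add_le (f.toPreGNS x) (f.toPreGNS y)

lemma gnsNorm_sub_le (x y : A) : gnsNorm f (x - y) ≤ gnsNorm f x + gnsNorm f y := by
  simpa [gnsNorm] using norm_sub_le (f.toPreGNS x) (f.toPreGNS y)

lemma gnsNorm_sum_le {ι : Type*} (s : Finset ι) (x : ι → A) :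
    gnsNorm f (∑ i ∈ s, x i) ≤ ∑ i ∈ s, gnsNorm f (x i) := by
  simpa [gnsNorm] using norm_sum_le s fun i => f.toPreGNS (x i)

lemma gnsNorm_smul (c : ℂ) (x : A) : gnsNorm f (c • x) = ‖c‖ * gnsNorm f x := by
  simpa [gnsNorm] using norm_smul c (f.toPreGNS x)

lemma gnsNorm_mul_le (a x : A) : gnsNorm f (a * x) ≤ ‖a‖ * gnsNorm f x := by
  have h := (f.leftMulMapPreGNS a).le_opNorm (f.toPreGNS x)
  have h2 : ‖f.leftMulMapPreGNS a‖ ≤ ‖a‖ := LinearMap.mkContinuous_norm_le _ (norm_nonneg _) _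
  exact h.trans (mul_le_mul_of_nonneg_right h2 (norm_nonneg _))

lemma norm_map_star_mul_le (x y : A) : ‖f (star x * y)‖ ≤ gnsNorm f x * gnsNorm f y :=
  norm_inner_le_norm (𝕜 := ℂ) (f.toPreGNS x) (f.toPreGNS y)

lemma gnsNorm_one (h1 : f 1 = 1) : gnsNorm f 1 = 1 := by
  have := gnsNorm_sq f 1
  rw [star_one, mul_one, h1] at this
  have h : gnsNorm f 1 ^ 2 = 1 := by exact_mod_cast this
  exact (pow_eq_one_iff_of_nonneg (gnsNorm_nonneg f 1) two_ne_zero).1 h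

lemma gnsNorm_le_norm (h1 : f 1 = 1) (x : A) : gnsNorm f x ≤ ‖x‖ := by
  simpa [gnsNorm_one f h1] using gnsNorm_mul_le f x 1

lemma norm_map_le_gnsNorm (h1 : f 1 = 1) (x : A) : ‖f x‖ ≤ gnsNorm f x := by
  simpa [gnsNorm_one f h1] using norm_map_star_mul_le f 1 x

lemma norm_map_le_norm (h1 : f 1 = 1) (x : A) : ‖f x‖ ≤ ‖x‖ :=
  (norm_map_le_gnsNorm f h1 x).trans (gnsNorm_le_norm f h1 x)

lemma continuous_of_map_one (h1 : f 1 = 1) : Continuous f :=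
  AddMonoidHomClass.continuous_of_bound f 1 (by simpa using norm_map_le_norm f h1)

lemma map_star_mul_swap (x y : A) : f (star x * y) = star (f (star y * x)) := by
  rw [← map_star f]; simp

lemma gnsNorm_add_sq_of_orthogonal {x y : A} (h : f (star x * y) = 0) :
    gnsNorm f (x + y) ^ 2 = gnsNorm f x ^ 2 + gnsNorm f y ^ 2 := by
  have h' : f (star y * x) = 0 := by rw [map_star_mul_swap, h, star_zero]
  have : ((gnsNorm f (x + y) ^ 2 : ℝ) : ℂ) = ((gnsNorm f x ^ 2 + gnsNorm f y ^ 2 : ℝ) : ℂ) := by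
    rw [Complex.ofReal_add, gnsNorm_sq, gnsNorm_sq, gnsNorm_sq, star_add, add_mul, mul_add, mul_add]
    simp [map_add, h, h']
  exact_mod_cast this

lemma gnsNorm_sum_sq_of_orthogonal {ι : Type*} (s : Finset ι) {x : ι → A}
    (h : ∀ i j, i ≠ j → f (star (x i) * x j) = 0) :
    gnsNorm f (∑ i ∈ s, x i) ^ 2 = ∑ i ∈ s, gnsNorm f (x i) ^ 2 := by
  classical
  induction s using Finset.induction_on with
  | empty => simp [gnsNorm]
  | insert a s ha ih =>
    rw [Finset.sum_insert ha, Finset.sum_insert ha, gnsNorm_add_sq_of_orthogonal, ih]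
    rw [Finset.mul_sum, map_sum]
    exact Finset.sum_eq_zero fun j hj => h _ _ fun e => ha (e ▸ hj)

end GNS

section FreeWords

variable {A I : Type*} [Ring A]

/-- The product of the letters of a word. -/
def wordProd (l : List (I × A)) : A := (l.map Prod.snd).prod

@[simp]
lemma wordProd_nil : wordProd ([] : List (I × A)) = 1 := rfl

@[simp]
lemma wordProd_cons (p : I × A) (l : List (I × A)) :
    wordProd (p :: l) = p.2 * wordProd l := by simp [wordProd]

lemma star_wordProd [StarRing A] (l : List (I × A)) :
    star (wordProd l) = wordProd ((l.map fun p => (p.1, star p.2)).reverse) := by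
  induction l with
  | nil => simp
  | cons p l ih =>
    rw [wordProd_cons, star_mul, ih]
    simp [wordProd]

variable [Algebra ℂ A]

/-- A reduced word: consecutive letters come from different algebras and all are centred. -/
def IsReducedWord (φ : A →ₗ[ℂ] ℂ) (S : I → Subalgebra ℂ A) (l : List (I × A)) : Prop :=
  l.IsChain (fun p q => p.1 ≠ q.1) ∧ ∀ p ∈ l, p.2 ∈ S p.1 ∧ φ p.2 = 0

variable {φ : A →ₗ[ℂ] ℂ} {S : I → Subalgebra ℂ A}

lemma isReducedWord_nil : IsReducedWord φ S [] := ⟨List.isChain_nil, by simp⟩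

lemma isReducedWord_cons {i : I} {a : A} {l : List (I × A)} :
    IsReducedWord φ S ((i, a) :: l) ↔
      (a ∈ S i ∧ φ a = 0) ∧ IsReducedWord φ S l ∧ ∀ p ∈ l.head?, p.1 ≠ i := by
  simp only [IsReducedWord, List.isChain_cons, List.mem_cons, forall_eq_or_imp]
  constructor
  · rintro ⟨⟨h1, h2⟩, h3, h4⟩
    exact ⟨h3, ⟨h2, h4⟩, fun p hp => (h1 p hp).symm⟩
  · rintro ⟨h3, ⟨h2, h4⟩, h1⟩
    exact ⟨⟨fun p hp => (h1 p hp).symm, h2⟩, h3, h4⟩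

lemma IsFreeFamily.map_wordProd (h : IsFreeFamily φ S) {l : List (I × A)}
    (hl : IsReducedWord φ S l) (hne : l ≠ []) : φ (wordProd l) = 0 := by
  obtain ⟨hc, hm⟩ := hl
  obtain ⟨k, hk⟩ : ∃ k, l.length = k + 1 :=
    ⟨l.length - 1, by have := List.length_pos_iff.2 hne; omega⟩
  have key := h k (fun j => (l.get (j.cast hk.symm)).1) ?_ (fun j => (l.get (j.cast hk.symm)).2)
    (fun j => (hm _ (List.get_mem _ _)).1) (fun j => (hm _ (List.get_mem _ _)).2)
  · have e : List.ofFn (fun j : Fin (k + 1) => (l.get (j.cast hk.symm)).2) = l.map Prod.snd := by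
      apply List.ext_get
      · simp [hk]
      · intro m h1 h2
        simp only [List.get_eq_getElem, List.getElem_ofFn, List.getElem_map, Fin.val_cast]
    rw [e] at key
    exact key
  · intro j
    have := List.isChain_iff_getElem.1 hc j (by omega)
    simpa using this

/-- The span of the reduced words not starting in `S i`. -/
def awaySpan (φ : A →ₗ[ℂ] ℂ) (S : I → Subalgebra ℂ A) (i : I) : Submodule ℂ A :=
  Submodule.span ℂ {x | ∃ l, IsReducedWord φ S l ∧ (∀ p ∈ l.head?, p.1 ≠ i) ∧ wordProd l = x}

/-- The span of the reduced words starting in `S i`. -/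
def headSpan (φ : A →ₗ[ℂ] ℂ) (S : I → Subalgebra ℂ A) (i : I) : Submodule ℂ A :=
  Submodule.span ℂ {x | ∃ a l, IsReducedWord φ S ((i, a) :: l) ∧ wordProd ((i, a) :: l) = x}

/-- The span of all reduced words. -/
def wordSpan (φ : A →ₗ[ℂ] ℂ) (S : I → Subalgebra ℂ A) : Submodule ℂ A :=
  Submodule.span ℂ {x | ∃ l, IsReducedWord φ S l ∧ wordProd l = x}

lemma headSpan_le_wordSpan (i : I) : headSpan φ S i ≤ wordSpan φ S :=
  Submodule.span_mono fun _ ⟨_, _, h, e⟩ => ⟨_, h, e⟩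

lemma headSpan_le_awaySpan {i j : I} (hij : j ≠ i) : headSpan φ S j ≤ awaySpan φ S i :=
  Submodule.span_mono fun _ ⟨_, _, h, e⟩ => ⟨_, h, by simpa using hij, e⟩

lemma one_mem_awaySpan (i : I) : (1 : A) ∈ awaySpan φ S i :=
  Submodule.subset_span ⟨[], isReducedWord_nil, by simp, rfl⟩

lemma one_mem_wordSpan : (1 : A) ∈ wordSpan φ S :=
  Submodule.subset_span ⟨[], isReducedWord_nil, rfl⟩

lemma mul_mem_headSpan {i : I} {a q : A} (ha : a ∈ S i) (ha0 : φ a = 0)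
    (hq : q ∈ awaySpan φ S i) : a * q ∈ headSpan φ S i := by
  induction hq using Submodule.span_induction with
  | mem x hx =>
    obtain ⟨l, hl, hh, rfl⟩ := hx
    exact Submodule.subset_span ⟨a, l, isReducedWord_cons.2 ⟨⟨ha, ha0⟩, hl, hh⟩, by simp⟩
  | zero => simp
  | add x y _ _ hx hy => rw [mul_add]; exact add_mem hx hy
  | smul c x _ hx => rw [mul_smul_comm]; exact Submodule.smul_mem _ _ hx

lemma mem_headSpan {i : I} {a : A} (ha : a ∈ S i) (ha0 : φ a = 0) : a ∈ headSpan φ S i := by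
  simpa using mul_mem_headSpan ha ha0 (one_mem_awaySpan i)

lemma sub_map_mem (h1 : φ 1 = 1) {i : I} {a : A} (ha : a ∈ S i) :
    a - φ a • (1 : A) ∈ S i ∧ φ (a - φ a • (1 : A)) = 0 :=
  ⟨sub_mem ha (Subalgebra.smul_mem _ (one_mem _) _), by simp [h1]⟩

lemma mul_mem_wordSpan (h1 : φ 1 = 1) {i : I} {a q : A} (ha : a ∈ S i)
    (hq : q ∈ wordSpan φ S) : a * q ∈ wordSpan φ S := by
  classical
  have split : ∀ b x : A, b * x = (b - φ b • (1 : A)) * x + φ b • x := fun b x => by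
    rw [sub_mul, smul_mul_assoc, one_mul, sub_add_cancel]
  induction hq using Submodule.span_induction with
  | mem x hx =>
    obtain ⟨l, hl, rfl⟩ := hx
    have away : ∀ b ∈ S i, ∀ l, IsReducedWord φ S l → (∀ p ∈ l.head?, p.1 ≠ i) →
        b * wordProd l ∈ wordSpan φ S := by
      intro b hb l hl hh
      rw [split]
      refine add_mem (headSpan_le_wordSpan i (mul_mem_headSpan (sub_map_mem h1 hb).1
        (sub_map_mem h1 hb).2 (Submodule.subset_span ⟨l, hl, hh, rfl⟩))) ?_
      exact Submodule.smul_mem _ _ (Submodule.subset_span ⟨l, hl, rfl⟩)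
    match l, hl with
    | [], hl => exact away a ha [] hl (by simp)
    | (k, b) :: l', hl =>
      by_cases hk : k = i
      · subst hk
        obtain ⟨hb, hl', hh⟩ := isReducedWord_cons.1 hl
        rw [wordProd_cons, ← mul_assoc]
        exact away _ (mul_mem ha hb.1) l' hl' hh
      · exact away a ha _ hl (by simpa using hk)
  | zero => simp
  | add x y _ _ hx hy => rw [mul_add]; exact add_mem hx hy
  | smul c x _ hx => rw [mul_smul_comm]; exact Submodule.smul_mem _ _ hx

lemma exists_decomposition [Fintype I] {q : A} (hq : q ∈ wordSpan φ S) :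
    ∃ (c : ℂ) (g : I → A), (∀ i, g i ∈ headSpan φ S i) ∧ q = c • (1 : A) + ∑ i, g i := by
  classical
  induction hq using Submodule.span_induction with
  | mem x hx =>
    obtain ⟨l, hl, rfl⟩ := hx
    match l, hl with
    | [], hl => exact ⟨1, 0, fun i => zero_mem _, by simp⟩
    | (k, b) :: l', hl =>
      refine ⟨0, Pi.single k (wordProd ((k, b) :: l')), fun i => ?_, by simp⟩
      by_cases hi : i = k
      · subst hi
        rw [Pi.single_eq_same]
        exact Submodule.subset_span ⟨b, l', hl, rfl⟩
      · simp [hi]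
  | zero => exact ⟨0, 0, fun i => zero_mem _, by simp⟩
  | add x y _ _ hx hy =>
    obtain ⟨c, g, hg, rfl⟩ := hx
    obtain ⟨c', g', hg', rfl⟩ := hy
    refine ⟨c + c', g + g', fun i => add_mem (hg i) (hg' i), ?_⟩
    simp only [add_smul, Pi.add_apply, Finset.sum_add_distrib]
    abel
  | smul r x _ hx =>
    obtain ⟨c, g, hg, rfl⟩ := hx
    exact ⟨r * c, r • g, fun i => Submodule.smul_mem _ _ (hg i), by
      simp [mul_smul, Finset.smul_sum]⟩

lemma decomposition_sub_mem_awaySpan [Fintype I] {c : ℂ} {g : I → A}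
    (hg : ∀ i, g i ∈ headSpan φ S i) (i : I) :
    (c • (1 : A) + ∑ j, g j) - g i ∈ awaySpan φ S i := by
  classical
  rw [← Finset.add_sum_erase _ _ (Finset.mem_univ i), add_left_comm, add_sub_cancel_left]
  refine add_mem (Submodule.smul_mem _ _ (one_mem_awaySpan i)) (sum_mem fun j hj => ?_)
  exact headSpan_le_awaySpan (Finset.ne_of_mem_erase hj) (hg j)

variable [StarRing A]

lemma IsReducedWord.star_reverse (hS : ∀ i, ∀ a ∈ S i, star a ∈ S i)
    (hφ : ∀ a, φ (star a) = star (φ a)) {l : List (I × A)} (hl : IsReducedWord φ S l) :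
    IsReducedWord φ S ((l.map fun p => (p.1, star p.2)).reverse) := by
  refine ⟨?_, ?_⟩
  · rw [List.isChain_reverse, List.isChain_map]
    exact hl.1.imp fun _ _ h => h.symm
  · intro p hp
    obtain ⟨q, hq, rfl⟩ := List.mem_map.1 (List.mem_reverse.1 hp)
    exact ⟨hS _ _ (hl.2 q hq).1, by simp [hφ, (hl.2 q hq).2]⟩

variable [StarModule ℂ A]

lemma map_star_awaySpan_mul_headSpan (h : IsFreeFamily φ S)
    (hS : ∀ i, ∀ a ∈ S i, star a ∈ S i) (hφ : ∀ a, φ (star a) = star (φ a))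
    {i : I} {q w : A} (hq : q ∈ awaySpan φ S i) (hw : w ∈ headSpan φ S i) :
    φ (star q * w) = 0 := by
  induction hq using Submodule.span_induction with
  | mem x hx =>
    obtain ⟨l, hl, hh, rfl⟩ := hx
    induction hw using Submodule.span_induction with
    | mem y hy =>
      obtain ⟨a, m, hm, rfl⟩ := hy
      have e : star (wordProd l) * wordProd ((i, a) :: m) =
          wordProd ((l.map fun p => (p.1, star p.2)).reverse ++ (i, a) :: m) := by
        rw [star_wordProd]; simp [wordProd]
      rw [e]
      have hl' := hl.star_reverse hS hφ
      refine h.map_wordProd ⟨?_, ?_⟩ (by simp)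
      · rw [List.isChain_append]
        refine ⟨hl'.1, hm.1, ?_⟩
        intro p hp q hq
        simp only [List.head?_cons, Option.mem_some_iff] at hq
        subst hq
        rw [List.getLast?_reverse, List.head?_map] at hp
        obtain ⟨r, hr, rfl⟩ := Option.mem_map.1 hp
        exact hh r hr
      · intro p hp
        rcases List.mem_append.1 hp with hp | hp
        · exact hl'.2 p hp
        · exact hm.2 p hp
    | zero => simp
    | add y z _ _ hy hz => rw [mul_add, map_add, hy, hz, add_zero]
    | smul c y _ hy => rw [mul_smul_comm, map_smul, hy, smul_zero]
  | zero => simp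
  | add x y _ _ hx hy => rw [star_add, add_mul, map_add, hx, hy, add_zero]
  | smul c x _ hx => rw [star_smul, smul_mul_assoc, map_smul, hx, smul_zero]

lemma map_star_awaySpan_mul_mul (h : IsFreeFamily φ S)
    (hS : ∀ i, ∀ a ∈ S i, star a ∈ S i) (hφ : ∀ a, φ (star a) = star (φ a)) (h1 : φ 1 = 1)
    {i : I} {x y b : A} (hx : x ∈ awaySpan φ S i) (hy : y ∈ awaySpan φ S i) (hb : b ∈ S i) :
    φ (star x * (b * y)) = φ b * φ (star x * y) := by
  have h0 := map_star_awaySpan_mul_headSpan h hS hφ hx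
    (mul_mem_headSpan (sub_map_mem h1 hb).1 (sub_map_mem h1 hb).2 hy)
  rw [sub_mul, mul_sub, map_sub, sub_eq_zero] at h0
  rw [h0, smul_mul_assoc, one_mul, mul_smul_comm, map_smul, smul_eq_mul]

end FreeWords

section FreeSums

open scoped ComplexOrder

variable {A I : Type*} [CStarAlgebra A] [PartialOrder A] [StarOrderedRing A]
  {f : A →ₚ[ℂ] ℂ} {S : I → Subalgebra ℂ A}

lemma gnsNorm_mul_eq_of_mem_awaySpan (h1 : f 1 = 1) (hfree : IsFreeFamily f.toLinearMap S)
    (hS : ∀ i, ∀ a ∈ S i, star a ∈ S i) {i : I} {b y : A} (hb : b ∈ S i)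
    (hy : y ∈ awaySpan f.toLinearMap S i) :
    gnsNorm f (b * y) = gnsNorm f b * gnsNorm f y := by
  have key : f (star y * (star b * b * y)) = f (star b * b) * f (star y * y) :=
    map_star_awaySpan_mul_mul hfree hS (fun a => map_star f a) h1 hy hy
      (mul_mem (hS i b hb) hb)
  have h2 : ((gnsNorm f (b * y) ^ 2 : ℝ) : ℂ) = (((gnsNorm f b * gnsNorm f y) ^ 2 : ℝ) : ℂ) := by
    rw [mul_pow, Complex.ofReal_mul, gnsNorm_sq, gnsNorm_sq, gnsNorm_sq, ← key, star_mul]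
    simp only [mul_assoc]
  have h3 : gnsNorm f (b * y) ^ 2 = (gnsNorm f b * gnsNorm f y) ^ 2 := by exact_mod_cast h2
  exact (pow_left_inj₀ (gnsNorm_nonneg _ _)
    (mul_nonneg (gnsNorm_nonneg _ _) (gnsNorm_nonneg _ _)) two_ne_zero).1 h3

lemma gnsNorm_sum_headSpan_sq [Fintype I] (hfree : IsFreeFamily f.toLinearMap S)
    (hS : ∀ i, ∀ a ∈ S i, star a ∈ S i) {g : I → A}
    (hg : ∀ i, g i ∈ headSpan f.toLinearMap S i) :
    gnsNorm f (∑ i, g i) ^ 2 = ∑ i, gnsNorm f (g i) ^ 2 :=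
  gnsNorm_sum_sq_of_orthogonal f _ fun i j hij =>
    map_star_awaySpan_mul_headSpan hfree hS (fun a => map_star f a)
      (headSpan_le_awaySpan hij (hg i)) (hg j)

lemma map_headSpan (hfree : IsFreeFamily f.toLinearMap S)
    (hS : ∀ i, ∀ a ∈ S i, star a ∈ S i) {i : I} {x : A}
    (hx : x ∈ headSpan f.toLinearMap S i) : f x = 0 := by
  simpa using map_star_awaySpan_mul_headSpan hfree hS (fun a => map_star f a)
    (one_mem_awaySpan i) hx

lemma gnsNorm_smul_one_add_sum_sq [Fintype I] (h1 : f 1 = 1)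
    (hfree : IsFreeFamily f.toLinearMap S)
    (hS : ∀ i, ∀ a ∈ S i, star a ∈ S i) {g : I → A}
    (hg : ∀ i, g i ∈ headSpan f.toLinearMap S i) (c : ℂ) :
    gnsNorm f (c • (1 : A) + ∑ i, g i) ^ 2 = ‖c‖ ^ 2 + ∑ i, gnsNorm f (g i) ^ 2 := by
  rw [gnsNorm_add_sq_of_orthogonal, gnsNorm_sum_headSpan_sq hfree hS hg, gnsNorm_smul,
    gnsNorm_one f h1, mul_one]
  simp [map_headSpan hfree hS (hg _)]

/-- Quadratic form bound for a sum of free centred elements (Voiculescu's inequality). -/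
lemma norm_map_star_mul_sum_mul_le [Fintype I] (h1 : f 1 = 1)
    (hfree : IsFreeFamily f.toLinearMap S) (hS : ∀ i, ∀ a ∈ S i, star a ∈ S i) {a : I → A}
    (ha : ∀ i, a i ∈ S i) (hsa : ∀ i, IsSelfAdjoint (a i)) (h0 : ∀ i, f (a i) = 0) {m : ℝ}
    (hm0 : 0 ≤ m) (hm : ∀ i, ‖a i‖ ≤ m) {y : A} (hy : y ∈ wordSpan f.toLinearMap S) :
    ‖f (star y * ((∑ i, a i) * y))‖ ≤
      (m + 2 * √(∑ i, gnsNorm f (a i) ^ 2)) * gnsNorm f y ^ 2 := by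
  classical
  obtain ⟨c, g, hg, hyg⟩ := exists_decomposition hy
  have hη : ∀ i, y - g i ∈ awaySpan f.toLinearMap S i := fun i =>
    hyg ▸ decomposition_sub_mem_awaySpan hg i
  have hηg : ∀ i, f (star (y - g i) * g i) = 0 := fun i =>
    map_star_awaySpan_mul_headSpan hfree hS (fun a => map_star f a) (hη i) (hg i)
  have hle : ∀ i, gnsNorm f (y - g i) ≤ gnsNorm f y := fun i => by
    have := gnsNorm_add_sq_of_orthogonal f (hηg i)
    rw [sub_add_cancel] at this
    refine le_of_sq_le_sq ?_ (gnsNorm_nonneg _ _)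
    nlinarith [sq_nonneg (gnsNorm f (g i))]
  have hsum : ∑ i, gnsNorm f (g i) ^ 2 ≤ gnsNorm f y ^ 2 := by
    rw [hyg, gnsNorm_smul_one_add_sum_sq h1 hfree hS hg]
    nlinarith [sq_nonneg ‖c‖]
  have hcross : ∀ i, ‖f (star (g i) * (a i * (y - g i)))‖ ≤
      gnsNorm f (g i) * gnsNorm f (a i) * gnsNorm f y := fun i => by
    refine (norm_map_star_mul_le f _ _).trans ?_
    rw [gnsNorm_mul_eq_of_mem_awaySpan h1 hfree hS (ha i) (hη i), mul_assoc]
    exact mul_le_mul_of_nonneg_left (mul_le_mul_of_nonneg_left (hle i) (gnsNorm_nonneg _ _))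
      (gnsNorm_nonneg _ _)
  have hterm : ∀ i, ‖f (star y * (a i * y))‖ ≤
      m * gnsNorm f (g i) ^ 2 + 2 * (gnsNorm f (g i) * gnsNorm f (a i) * gnsNorm f y) := fun i => by
    have e : f (star y * (a i * y)) = f (star (g i) * (a i * g i)) +
        f (star (g i) * (a i * (y - g i))) + star (f (star (g i) * (a i * (y - g i)))) +
        f (star (y - g i) * (a i * (y - g i))) := by
      rw [← map_star f (star (g i) * _), star_mul, star_mul, star_star, (hsa i).star_eq,
        ← map_add, ← map_add, ← map_add]
      congr 1
      simp only [star_sub]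
      noncomm_ring
    have e4 : f (star (y - g i) * (a i * (y - g i))) = 0 := by
      have := map_star_awaySpan_mul_mul hfree hS (fun a => map_star f a) h1 (hη i) (hη i) (ha i)
      refine this.trans ?_
      simp [h0 i]
    have e1 : ‖f (star (g i) * (a i * g i))‖ ≤ m * gnsNorm f (g i) ^ 2 := by
      refine (norm_map_star_mul_le f _ _).trans ?_
      have := gnsNorm_mul_le f (a i) (g i)
      have h' := hm i
      have := gnsNorm_nonneg f (g i)
      calc _ ≤ gnsNorm f (g i) * (‖a i‖ * gnsNorm f (g i)) := by gcongr
        _ ≤ gnsNorm f (g i) * (m * gnsNorm f (g i)) := by gcongr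
        _ = _ := by ring
    rw [e, e4, add_zero]
    refine (norm_add₃_le).trans ?_
    rw [norm_star]
    linarith [hcross i]
  have hcs : ∑ i, gnsNorm f (g i) * gnsNorm f (a i) ≤
      gnsNorm f y * √(∑ i, gnsNorm f (a i) ^ 2) := by
    refine (Real.sum_mul_le_sqrt_mul_sqrt _ _ _).trans ?_
    refine mul_le_mul_of_nonneg_right ?_ (Real.sqrt_nonneg _)
    exact Real.sqrt_le_iff.2 ⟨gnsNorm_nonneg _ _, hsum⟩
  calc ‖f (star y * ((∑ i, a i) * y))‖ = ‖∑ i, f (star y * (a i * y))‖ := by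
        rw [Finset.sum_mul, Finset.mul_sum, map_sum]
    _ ≤ ∑ i, (m * gnsNorm f (g i) ^ 2 +
        2 * (gnsNorm f (g i) * gnsNorm f (a i) * gnsNorm f y)) :=
        norm_sum_le_of_le _ fun i _ => hterm i
    _ = m * ∑ i, gnsNorm f (g i) ^ 2 +
        2 * ((∑ i, gnsNorm f (g i) * gnsNorm f (a i)) * gnsNorm f y) := by
        rw [Finset.sum_add_distrib, ← Finset.mul_sum, ← Finset.mul_sum, ← Finset.sum_mul]
    _ ≤ m * gnsNorm f y ^ 2 +
        2 * ((gnsNorm f y * √(∑ i, gnsNorm f (a i) ^ 2)) * gnsNorm f y) := by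
        have := gnsNorm_nonneg f y
        gcongr
    _ = _ := by ring

end FreeSums

section FreeSumNorm

open scoped ComplexOrder

lemma cfc_mem_closure_of_mul_mem {A : Type*} [CStarAlgebra A] {V : Submodule ℂ A} {x : A}
    (hx : IsSelfAdjoint x) (h1 : (1 : A) ∈ V) (hV : ∀ y ∈ V, x * y ∈ V) (u : ℝ → ℝ) :
    cfc u x ∈ closure (V : Set A) := by
  have h := cfc_mem_elemental (𝕜 := ℝ) u x
  have hsub : ((StarAlgebra.adjoin ℝ {x} : StarSubalgebra ℝ A) : Set A) ⊆ V := by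
    intro p hp
    have hp' : p ∈ Algebra.adjoin ℝ ({x} : Set A) := by
      have : p ∈ (StarAlgebra.adjoin ℝ {x} : StarSubalgebra ℝ A).toSubalgebra := hp
      rw [StarAlgebra.adjoin_toSubalgebra] at this
      simpa [Set.star_singleton, hx.star_eq] using this
    have key : ∀ y ∈ V, p * y ∈ V := by
      clear hp
      induction hp' using Algebra.adjoin_induction with
      | mem q hq => rw [Set.mem_singleton_iff.1 hq]; exact hV
      | algebraMap r =>
        intro y hy
        rw [Algebra.algebraMap_eq_smul_one, smul_mul_assoc, one_mul]
        exact V.smul_of_tower_mem r hy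
      | add q r _ _ hq hr => exact fun y hy => by rw [add_mul]; exact add_mem (hq y hy) (hr y hy)
      | mul q r _ _ hq hr => exact fun y hy => by rw [mul_assoc]; exact hq _ (hr y hy)
    simpa using key 1 h1
  exact closure_mono hsub h

variable {A I : Type*} [CStarAlgebra A] [PartialOrder A] [StarOrderedRing A]
  {f : A →ₚ[ℂ] ℂ} {S : I → Subalgebra ℂ A}

lemma spectrum_le_of_quadratic_form_le (hf : ∀ x, f (star x * x) = 0 → x = 0)
    (h1 : f 1 = 1) {V : Submodule ℂ A}
    {x : A} (hx : IsSelfAdjoint x) (h1V : (1 : A) ∈ V) (hV : ∀ y ∈ V, x * y ∈ V) {c : ℝ}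
    (hc : ∀ y ∈ V, ‖f (star y * (x * y))‖ ≤ c * gnsNorm f y ^ 2) :
    ∀ t ∈ spectrum ℝ x, t ≤ c := by
  have hcont := continuous_of_map_one f h1
  have hre : ∀ y, gnsNorm f y ^ 2 = (f (star y * y)).re := fun y => by
    rw [← gnsNorm_sq, Complex.ofReal_re]
  have hcl : ∀ y ∈ closure (V : Set A), ‖f (star y * (x * y))‖ ≤ c * (f (star y * y)).re := by
    intro y hy
    have hclosed : IsClosed {y : A | ‖f (star y * (x * y))‖ ≤ c * (f (star y * y)).re} :=
      isClosed_le (by fun_prop) (by fun_prop)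
    exact closure_minimal (fun y hy => (hc y hy).trans_eq (by rw [hre])) hclosed hy
  set u : ℝ → ℝ := fun t => √(max (t - c) 0) with hu
  set w : ℝ → ℝ := fun t => max (t - c) 0 with hw
  have hucont : Continuous u := by fun_prop
  have hwcont : Continuous w := by fun_prop
  have hy := hcl _ (cfc_mem_closure_of_mul_mem hx h1V hV u)
  have hsa : star (cfc u x) = cfc u x := (cfc_predicate u x).star_eq
  have hsaw : star (cfc w x) = cfc w x := (cfc_predicate w x).star_eq
  have e1 : cfc u x * cfc u x = cfc w x := by
    rw [← cfc_mul u u x]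
    refine cfc_congr fun t _ => ?_
    exact Real.mul_self_sqrt (le_max_right _ _)
  have e2 : cfc u x * (x * cfc u x) = star (cfc w x) * cfc w x + c • cfc w x := by
    have ex : x * cfc u x = cfc (fun t => t * u t) x := by
      rw [cfc_mul (fun t => t) u x, cfc_id' ℝ x]
    rw [hsaw, ex, ← cfc_mul u _ x, ← cfc_mul w w x, ← cfc_smul c w x,
      ← cfc_add ..]
    refine cfc_congr fun t _ => ?_
    have h2 : u t * u t = w t := Real.mul_self_sqrt (le_max_right _ _)
    have h3 : w t * w t = (t - c) * w t := by
      rcases le_total (t - c) 0 with h | h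
      · simp [hw, h]
      · simp [hw, h]
    simp only [smul_eq_mul]
    linear_combination t * h2 - h3
  rw [hsa, e2, e1, map_add] at hy
  have e3 : f (c • cfc w x) = c * f (cfc w x) := by
    rw [← Complex.coe_smul, map_smul, smul_eq_mul]
  have hle : (f (star (cfc w x) * cfc w x)).re ≤ 0 := by
    have := (Complex.re_le_norm _).trans hy
    rw [e3, Complex.add_re, Complex.re_ofReal_mul] at this
    linarith
  have h0 : f (star (cfc w x) * cfc w x) = 0 := by
    rw [← gnsNorm_sq] at hle ⊢
    rw [Complex.ofReal_re] at hle
    rw [le_antisymm hle (sq_nonneg _), Complex.ofReal_zero]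
  have hw0 : cfc w x = 0 := hf _ h0
  intro t ht
  have hmem : w t ∈ spectrum ℝ (cfc w x) := by
    rw [cfc_map_spectrum w x]
    exact ⟨t, ht, rfl⟩
  have : Nontrivial A := by
    refine ⟨⟨1, 0, fun h => ?_⟩⟩
    rw [h, map_zero] at h1
    exact zero_ne_one h1
  rw [hw0, spectrum.zero_eq, Set.mem_singleton_iff] at hmem
  have := le_max_left (t - c) 0
  simp only [hw] at hmem
  linarith

/-- Voiculescu's inequality for sums of free centred self-adjoint elements. -/
lemma norm_sum_le_of_isFreeFamily [Fintype I] (hf : ∀ x, f (star x * x) = 0 → x = 0)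
    (h1 : f 1 = 1)
    (hfree : IsFreeFamily f.toLinearMap S) (hS : ∀ i, ∀ a ∈ S i, star a ∈ S i) {a : I → A}
    (ha : ∀ i, a i ∈ S i) (hsa : ∀ i, IsSelfAdjoint (a i)) (h0 : ∀ i, f (a i) = 0) {m : ℝ}
    (hm0 : 0 ≤ m) (hm : ∀ i, ‖a i‖ ≤ m) :
    ‖∑ i, a i‖ ≤ m + 2 * √(∑ i, gnsNorm f (a i) ^ 2) := by
  set c := m + 2 * √(∑ i, gnsNorm f (a i) ^ 2) with hc
  have hx : IsSelfAdjoint (∑ i, a i) := isSelfAdjoint_sum _ fun i _ => hsa i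
  have hV : ∀ y ∈ wordSpan f.toLinearMap S, (∑ i, a i) * y ∈ wordSpan f.toLinearMap S := by
    intro y hy
    rw [Finset.sum_mul]
    exact sum_mem fun i _ => mul_mem_wordSpan h1 (ha i) hy
  have hq := fun y (hy : y ∈ wordSpan f.toLinearMap S) =>
    norm_map_star_mul_sum_mul_le h1 hfree hS ha hsa h0 hm0 hm hy
  have hup := spectrum_le_of_quadratic_form_le hf h1 hx one_mem_wordSpan hV hq
  have hlow := spectrum_le_of_quadratic_form_le hf h1 hx.neg one_mem_wordSpan
    (fun y hy => by rw [neg_mul]; exact neg_mem (hV y hy))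
    (fun y hy => by rw [neg_mul, mul_neg, map_neg, norm_neg]; exact hq y hy)
  rw [← cfc_id' ℝ (∑ i, a i)]
  refine norm_cfc_le (by positivity) fun t ht => ?_
  rw [Real.norm_eq_abs, abs_le']
  refine ⟨hup t ht, hlow (-t) ?_⟩
  rw [← spectrum.neg_eq]
  simpa using ht

end FreeSumNorm

section SelfNormalized

open scoped ComplexOrder

lemma norm_one_le_one {A : Type*} [CStarAlgebra A] : ‖(1 : A)‖ ≤ 1 := by
  rcases subsingleton_or_nontrivial A with h | h
  · simp [Subsingleton.elim (1 : A) 0]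
  · rw [CStarRing.norm_one]

lemma star_mem_adjoin_singleton {A : Type*} [CStarAlgebra A] {x a : A} (hx : IsSelfAdjoint x)
    (ha : a ∈ Algebra.adjoin ℂ {x}) : star a ∈ Algebra.adjoin ℂ {x} := by
  induction ha using Algebra.adjoin_induction with
  | mem q hq =>
    rw [Set.mem_singleton_iff.1 hq, hx.star_eq]
    exact Algebra.self_mem_adjoin_singleton ℂ x
  | algebraMap r => rw [← algebraMap_star_comm]; exact Subalgebra.algebraMap_mem _ _
  | add q r _ _ hq hr => rw [star_add]; exact add_mem hq hr
  | mul q r _ _ hq hr => rw [star_mul]; exact mul_mem hr hq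

lemma norm_conj_sub_le {A : Type*} [CStarAlgebra A] {W s : A} {η : ℝ} (hη : η ≤ 1)
    (hW : ‖W - 1‖ ≤ η) (hs : ‖s‖ ≤ 3) : ‖W * s * W - s‖ ≤ 9 * η := by
  have e : W * s * W - s = (W - 1) * s * (W - 1) + (W - 1) * s + s * (W - 1) := by noncomm_ring
  have hη0 := (norm_nonneg _).trans hW
  have b1 : ‖(W - 1) * s‖ ≤ η * 3 :=
    (norm_mul_le _ _).trans (mul_le_mul hW hs (norm_nonneg _) hη0)
  have b2 : ‖s * (W - 1)‖ ≤ 3 * η :=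
    (norm_mul_le _ _).trans (mul_le_mul hs hW (norm_nonneg _) (by norm_num))
  have b3 : ‖(W - 1) * s * (W - 1)‖ ≤ η * 3 * 1 :=
    (norm_mul_le _ _).trans (mul_le_mul b1 (hW.trans hη) (norm_nonneg _) (by positivity))
  rw [e]
  refine norm_add₃_le.trans ?_
  linarith

variable {A I : Type*} [CStarAlgebra A] [PartialOrder A] [StarOrderedRing A]
  {f : A →ₚ[ℂ] ℂ} {X : I → A} {σ : I → ℝ}

lemma gnsNorm_sq_of_isSelfAdjoint {x : A} {s : ℝ} (hx : IsSelfAdjoint x)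
    (h : f (x ^ 2) = ((s ^ 2 : ℝ) : ℂ)) : gnsNorm f x ^ 2 = s ^ 2 := by
  have := gnsNorm_sq f x
  rw [hx.star_eq, ← sq, h] at this
  exact_mod_cast this

lemma variance_le_norm_sq (h1 : f 1 = 1) {x : A} {s : ℝ} (hx : IsSelfAdjoint x)
    (h : f (x ^ 2) = ((s ^ 2 : ℝ) : ℂ)) : s ^ 2 ≤ ‖x‖ ^ 2 := by
  rw [← gnsNorm_sq_of_isSelfAdjoint hx h]
  exact pow_le_pow_left₀ (gnsNorm_nonneg _ _) (gnsNorm_le_norm f h1 x) 2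

lemma gnsNorm_sub_map_smul_one_le (h1 : f 1 = 1) (x : A) :
    gnsNorm f (x - f x • (1 : A)) ≤ gnsNorm f x := by
  have h := gnsNorm_add_sq_of_orthogonal f (x := f x • (1 : A)) (y := x - f x • (1 : A)) (by
    simp [map_sub, h1])
  rw [add_sub_cancel] at h
  refine le_of_sq_le_sq ?_ (gnsNorm_nonneg _ _)
  nlinarith [sq_nonneg (gnsNorm f (f x • (1 : A)))]

lemma norm_sum_sq_sub_one_le [Fintype I] (hf : ∀ x, f (star x * x) = 0 → x = 0)
    (h1 : f 1 = 1) (hX : ∀ i, IsSelfAdjoint (X i))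
    (hfree : IsFreeFamily f.toLinearMap fun i => Algebra.adjoin ℂ {X i})
    (h2 : ∀ i, f (X i ^ 2) = ((σ i ^ 2 : ℝ) : ℂ)) (hB : ∑ i, σ i ^ 2 = 1) :
    ‖∑ i, X i ^ 2 - 1‖ ≤ 4 * √(∑ i, ‖X i‖ ^ 4) := by
  set L := ∑ i, ‖X i‖ ^ 4 with hL
  have e : ∑ i, X i ^ 2 - 1 = ∑ i, (X i ^ 2 - f (X i ^ 2) • (1 : A)) := by
    rw [Finset.sum_sub_distrib, ← Finset.sum_smul]
    simp only [h2]
    rw [← Complex.ofReal_sum, hB, Complex.ofReal_one, one_smul]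
  have hκ : ∀ i, ‖X i‖ ^ 2 ≤ √L := fun i => by
    refine Real.le_sqrt_of_sq_le ?_
    rw [← pow_mul]
    exact Finset.single_le_sum (f := fun i => ‖X i‖ ^ 4) (fun i _ => by positivity)
      (Finset.mem_univ i)
  have hmem : ∀ i, X i ^ 2 - f (X i ^ 2) • (1 : A) ∈ Algebra.adjoin ℂ {X i} := fun i =>
    sub_mem (pow_mem (Algebra.self_mem_adjoin_singleton ℂ _) _)
      (Subalgebra.smul_mem _ (one_mem _) _)
  have hg : ∀ i, gnsNorm f (X i ^ 2 - f (X i ^ 2) • (1 : A)) ^ 2 ≤ ‖X i‖ ^ 4 := fun i => by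
    have := (gnsNorm_sub_map_smul_one_le h1 (X i ^ 2)).trans
      ((gnsNorm_le_norm f h1 _).trans (norm_pow_le' (X i) two_pos))
    refine (pow_le_pow_left₀ (gnsNorm_nonneg _ _) this 2).trans_eq ?_
    ring
  have key := norm_sum_le_of_isFreeFamily (a := fun i => X i ^ 2 - f (X i ^ 2) • (1 : A))
    (m := 2 * √L) hf h1 hfree
    (fun i a ha => star_mem_adjoin_singleton (hX i) ha) hmem ?_ (fun i => by simp [h1])
    (by positivity) ?_
  · rw [e]
    refine key.trans ?_
    have : √(∑ i, gnsNorm f (X i ^ 2 - f (X i ^ 2) • (1 : A)) ^ 2) ≤ √L :=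
      Real.sqrt_le_sqrt (Finset.sum_le_sum fun i _ => hg i)
    linarith
  · intro i
    rw [h2 i]
    refine ((hX i).pow 2).sub ?_
    rw [Complex.coe_smul]
    exact (IsSelfAdjoint.all (σ i ^ 2)).smul (.one A)
  · intro i
    refine (norm_sub_le _ _).trans ?_
    have a1 := norm_pow_le' (X i) two_pos
    have a2 : ‖f (X i ^ 2) • (1 : A)‖ ≤ ‖X i‖ ^ 2 := by
      rw [norm_smul]
      calc _ ≤ ‖X i ^ 2‖ * 1 :=
            mul_le_mul (norm_map_le_norm f h1 _) norm_one_le_one (norm_nonneg _) (norm_nonneg _)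
        _ ≤ _ := by rw [mul_one]; exact a1
    linarith [hκ i]

lemma norm_sum_le_three [Fintype I] (hf : ∀ x, f (star x * x) = 0 → x = 0)
    (h1 : f 1 = 1) (hX : ∀ i, IsSelfAdjoint (X i))
    (hfree : IsFreeFamily f.toLinearMap fun i => Algebra.adjoin ℂ {X i})
    (h0 : ∀ i, f (X i) = 0)
    (h2 : ∀ i, f (X i ^ 2) = ((σ i ^ 2 : ℝ) : ℂ)) (hB : ∑ i, σ i ^ 2 = 1)
    (hL : ∀ i, ‖X i‖ ≤ 1) : ‖∑ i, X i‖ ≤ 3 := by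
  have key := norm_sum_le_of_isFreeFamily (a := X) (m := 1) hf h1 hfree
    (fun i a ha => star_mem_adjoin_singleton (hX i) ha)
    (fun i => Algebra.self_mem_adjoin_singleton ℂ _) hX h0 zero_le_one hL
  refine key.trans_eq ?_
  simp only [gnsNorm_sq_of_isSelfAdjoint (hX _) (h2 _), hB]
  norm_num

/-- On nonnegative elements the map `W ↦ W ^ 4` moves away from `1`. -/
lemma norm_sub_one_le_norm_pow_four_sub_one {W : A} (hW : 0 ≤ W) : ‖W - 1‖ ≤ ‖W ^ 4 - 1‖ := by
  have hsa : IsSelfAdjoint W := .of_nonneg hW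
  have e1 : W - 1 = cfc (fun t : ℝ => t - 1) W := by
    rw [cfc_sub (fun t : ℝ => t) (fun _ => 1) W, cfc_id' ℝ W, cfc_const_one ℝ W]
  have e4 : W ^ 4 - 1 = cfc (fun t : ℝ => t ^ 4 - 1) W := by
    rw [cfc_sub (fun t : ℝ => t ^ 4) (fun _ => 1) W, cfc_pow_id (R := ℝ) W 4, cfc_const_one ℝ W]
  rw [e1, e4]
  refine norm_cfc_le (norm_nonneg _) fun t ht => ?_
  have ht0 : 0 ≤ t := spectrum_nonneg_of_nonneg hW ht
  refine le_trans ?_ (norm_apply_le_norm_cfc (fun t : ℝ => t ^ 4 - 1) W ht)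
  have : t ^ 4 - 1 = (t - 1) * (1 + t + t ^ 2 + t ^ 3) := by ring
  rw [this, norm_mul]
  refine le_mul_of_one_le_right (norm_nonneg _) ?_
  rw [Real.norm_of_nonneg (by positivity)]
  nlinarith [pow_nonneg ht0 2, pow_nonneg ht0 3]

lemma norm_inv_fourth_root_sub_one_le {W V : A} (hW : 0 ≤ W) (hWV : W ^ 4 * V = 1) {δ : ℝ}
    (hδ : δ ≤ 1 / 2) (hV : ‖V - 1‖ ≤ δ) : ‖W - 1‖ ≤ 2 * δ := by
  have e : W ^ 4 - 1 = -(W ^ 4 * (V - 1)) := by rw [mul_sub, hWV]; simp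
  have h := norm_mul_le (W ^ 4) (V - 1)
  have h2 : ‖W ^ 4‖ ≤ 1 + ‖W ^ 4 - 1‖ := by
    have := norm_add_le (1 : A) (W ^ 4 - 1)
    rw [add_sub_cancel] at this
    linarith [norm_one_le_one (A := A)]
  have h3 : ‖W ^ 4 - 1‖ ≤ ‖W ^ 4‖ * ‖V - 1‖ := by rw [e, norm_neg]; exact h
  have h4 := norm_nonneg (W ^ 4)
  have h5 := norm_nonneg (V - 1)
  have h6 := norm_sub_one_le_norm_pow_four_sub_one hW
  nlinarith

end SelfNormalized

section ApproximateInverse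

open scoped ComplexOrder

variable {A I : Type*} [CStarAlgebra A] [Fintype I]

/-- The components of the iterates of the fixed point equation `t i = h i * (1 + ∑ t j - t i)`. -/
def freeIterate (h : I → A) : ℕ → I → A
  | 0 => 0
  | k + 1 => fun i => h i * (1 + ∑ j, freeIterate h k j - freeIterate h k i)

lemma freeIterate_succ (h : I → A) (k : ℕ) (i : I) :
    freeIterate h (k + 1) i = h i * (1 + ∑ j, freeIterate h k j - freeIterate h k i) := rfl

lemma freeIterate_sub_succ (h : I → A) (k : ℕ) (i : I) :
    freeIterate h (k + 2) i - freeIterate h (k + 1) i =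
      h i * (∑ j, (freeIterate h (k + 1) j - freeIterate h k j) -
        (freeIterate h (k + 1) i - freeIterate h k i)) := by
  rw [freeIterate_succ, freeIterate_succ h k, ← mul_sub, Finset.sum_sub_distrib]
  congr 1
  abel

lemma one_sub_sum_mul_freeIterate (a h : I → A) (k : ℕ) :
    (1 - ∑ i, a i) * (1 + ∑ j, freeIterate h (k + 1) j) =
      1 + ∑ i, ((1 - a i) * (1 + h i) - 1) * (1 + ∑ j, freeIterate h k j - freeIterate h k i) -
      ∑ i, a i * (∑ j, (freeIterate h (k + 1) j - freeIterate h k j) -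
        (freeIterate h (k + 1) i - freeIterate h k i)) := by
  have e : ∀ i, ((1 - a i) * (1 + h i) - 1) * (1 + ∑ j, freeIterate h k j - freeIterate h k i) =
      freeIterate h (k + 1) i - a i * freeIterate h (k + 1) i -
        a i * (1 + ∑ j, freeIterate h k j - freeIterate h k i) := fun i => by
    rw [freeIterate_succ h k i]
    noncomm_ring
  have e2 : ∀ i, freeIterate h (k + 1) i - a i * freeIterate h (k + 1) i -
        a i * (1 + ∑ j, freeIterate h k j - freeIterate h k i) -
        a i * (∑ j, (freeIterate h (k + 1) j - freeIterate h k j) -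
          (freeIterate h (k + 1) i - freeIterate h k i)) =
      freeIterate h (k + 1) i - a i * (1 + ∑ j, freeIterate h (k + 1) j) := fun i => by
    rw [Finset.sum_sub_distrib]
    noncomm_ring
  simp only [e]
  rw [add_sub_assoc, ← Finset.sum_sub_distrib]
  simp only [e2]
  rw [Finset.sum_sub_distrib, ← Finset.sum_mul]
  noncomm_ring

variable [PartialOrder A] [StarOrderedRing A] {f : A →ₚ[ℂ] ℂ} {S : I → Subalgebra ℂ A}

lemma gnsNorm_sub_head_le (hfree : IsFreeFamily f.toLinearMap S)
    (hS : ∀ i, ∀ a ∈ S i, star a ∈ S i) {g : I → A}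
    (hg : ∀ i, g i ∈ headSpan f.toLinearMap S i) (c : ℂ) (i : I) :
    gnsNorm f ((c • (1 : A) + ∑ j, g j) - g i) ≤ gnsNorm f (c • (1 : A) + ∑ j, g j) := by
  have h := gnsNorm_add_sq_of_orthogonal f
    (map_star_awaySpan_mul_headSpan hfree hS (fun a => map_star f a)
      (decomposition_sub_mem_awaySpan hg i (c := c)) (hg i))
  rw [sub_add_cancel] at h
  refine le_of_sq_le_sq ?_ (gnsNorm_nonneg _ _)
  nlinarith [sq_nonneg (gnsNorm f (g i))]

/-- One step of the iteration contracts the `L²`-norm. -/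
lemma sum_gnsNorm_mul_sub_head_sq_le (h1 : f 1 = 1) (hfree : IsFreeFamily f.toLinearMap S)
    (hS : ∀ i, ∀ a ∈ S i, star a ∈ S i) {g h : I → A} (hh : ∀ i, h i ∈ S i)
    (hg : ∀ i, g i ∈ headSpan f.toLinearMap S i) (c : ℂ) {θ : ℝ}
    (hθ : ∑ i, gnsNorm f (h i) ^ 2 ≤ θ) :
    ∑ i, gnsNorm f (h i * ((c • (1 : A) + ∑ j, g j) - g i)) ^ 2 ≤
      θ * gnsNorm f (c • (1 : A) + ∑ j, g j) ^ 2 := by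
  refine le_trans ?_ (mul_le_mul_of_nonneg_right hθ (sq_nonneg _))
  rw [Finset.sum_mul]
  refine Finset.sum_le_sum fun i _ => ?_
  rw [gnsNorm_mul_eq_of_mem_awaySpan h1 hfree hS (hh i) (decomposition_sub_mem_awaySpan hg i),
    mul_pow]
  exact mul_le_mul_of_nonneg_left (pow_le_pow_left₀ (gnsNorm_nonneg _ _)
    (gnsNorm_sub_head_le hfree hS hg c i) 2) (sq_nonneg _)

lemma freeIterate_mem_headSpan {h : I → A} (hh : ∀ i, h i ∈ S i) (h0 : ∀ i, f (h i) = 0)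
    (k : ℕ) (i : I) : freeIterate h k i ∈ headSpan f.toLinearMap S i := by
  induction k generalizing i with
  | zero => exact zero_mem _
  | succ k ih =>
    rw [freeIterate_succ]
    refine mul_mem_headSpan (hh i) (h0 i) ?_
    simpa using decomposition_sub_mem_awaySpan ih i (c := 1)

lemma gnsNorm_freeIterate_sq_le (h1 : f 1 = 1) (hfree : IsFreeFamily f.toLinearMap S)
    (hS : ∀ i, ∀ a ∈ S i, star a ∈ S i) {h : I → A} (hh : ∀ i, h i ∈ S i)
    (h0 : ∀ i, f (h i) = 0) {θ : ℝ} (hθ : ∑ i, gnsNorm f (h i) ^ 2 ≤ θ) (hθ1 : θ < 1) (k : ℕ) :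
    gnsNorm f (1 + ∑ j, freeIterate h k j) ^ 2 ≤ (1 - θ)⁻¹ := by
  have hθ0 : 0 ≤ θ := (Finset.sum_nonneg fun i _ => sq_nonneg _).trans hθ
  induction k with
  | zero =>
    simp only [freeIterate, Pi.zero_apply, Finset.sum_const_zero, add_zero, gnsNorm_one f h1,
      one_pow]
    exact (one_le_inv₀ (by linarith)).2 (by linarith)
  | succ k ih =>
    have e := gnsNorm_smul_one_add_sum_sq h1 hfree hS
      (freeIterate_mem_headSpan hh h0 (k + 1)) 1
    have b := sum_gnsNorm_mul_sub_head_sq_le h1 hfree hS hh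
      (freeIterate_mem_headSpan hh h0 k) 1 hθ
    simp only [one_smul] at e b
    rw [e]
    simp only [freeIterate_succ]
    have hθ' : 1 - θ ≠ 0 := by linarith
    calc _ ≤ ‖(1 : ℂ)‖ ^ 2 + θ * (1 - θ)⁻¹ := by
          have := mul_le_mul_of_nonneg_left ih hθ0
          linarith
      _ = (1 - θ)⁻¹ := by
          rw [norm_one]; field_simp; ring

lemma gnsNorm_freeIterate_sub_sq_le (h1 : f 1 = 1) (hfree : IsFreeFamily f.toLinearMap S)
    (hS : ∀ i, ∀ a ∈ S i, star a ∈ S i) {h : I → A} (hh : ∀ i, h i ∈ S i)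
    (h0 : ∀ i, f (h i) = 0) {θ : ℝ} (hθ : ∑ i, gnsNorm f (h i) ^ 2 ≤ θ) (k : ℕ) :
    gnsNorm f (∑ j, (freeIterate h (k + 1) j - freeIterate h k j)) ^ 2 ≤ θ ^ (k + 1) := by
  have hθ0 : 0 ≤ θ := (Finset.sum_nonneg fun i _ => sq_nonneg _).trans hθ
  have hmem : ∀ k i, freeIterate h (k + 1) i - freeIterate h k i ∈ headSpan f.toLinearMap S i :=
    fun k i => sub_mem (freeIterate_mem_headSpan hh h0 _ i) (freeIterate_mem_headSpan hh h0 _ i)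
  induction k with
  | zero =>
    rw [gnsNorm_sum_headSpan_sq hfree hS (hmem 0)]
    simpa [freeIterate] using hθ
  | succ k ih =>
    rw [gnsNorm_sum_headSpan_sq hfree hS (hmem (k + 1))]
    have b := sum_gnsNorm_mul_sub_head_sq_le h1 hfree hS hh (hmem k) 0 hθ
    simp only [zero_smul, zero_add] at b
    simp only [freeIterate_sub_succ]
    refine b.trans ?_
    rw [pow_succ' θ (k + 1)]
    exact mul_le_mul_of_nonneg_left ih hθ0

/-- If `∑ ‖(1 - a i) (1 + h i) - 1‖` is small, then a left inverse of a perturbation of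
`1 - ∑ a i` has expectation close to `1`. -/
lemma norm_map_leftInverse_sub_one_le (h1 : f 1 = 1) (hfree : IsFreeFamily f.toLinearMap S)
    (hS : ∀ i, ∀ a ∈ S i, star a ∈ S i) {a h : I → A} (hh : ∀ i, h i ∈ S i)
    (h0 : ∀ i, f (h i) = 0) {θ β γ : ℝ} (hθ : ∑ i, gnsNorm f (h i) ^ 2 ≤ θ) (hθ1 : θ < 1)
    {Y R : A} (hR : R * Y = 1) (hY : ‖Y - (1 - ∑ i, a i)‖ ≤ β)
    (hρ : ∑ i, ‖(1 - a i) * (1 + h i) - 1‖ ≤ γ) :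
    ‖f R - 1‖ ≤ gnsNorm f (star R) * ((β + γ) * √(1 - θ)⁻¹) := by
  have hθ0 : 0 ≤ θ := (Finset.sum_nonneg fun i _ => sq_nonneg _).trans hθ
  have hβ0 : 0 ≤ β := (norm_nonneg _).trans hY
  set τ := √(1 - θ)⁻¹ with hτ
  have hmem := freeIterate_mem_headSpan (f := f) hh h0
  have hN : ∀ k, gnsNorm f (1 + ∑ j, freeIterate h k j) ≤ τ := fun k =>
    Real.le_sqrt_of_sq_le (gnsNorm_freeIterate_sq_le h1 hfree hS hh h0 hθ hθ1 k)
  have hD : ∀ k, gnsNorm f (∑ j, (freeIterate h (k + 1) j - freeIterate h k j)) ≤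
      √θ ^ (k + 1) := fun k => by
    refine le_of_sq_le_sq ?_ (by positivity)
    refine (gnsNorm_freeIterate_sub_sq_le h1 hfree hS hh h0 hθ k).trans_eq ?_
    rw [← pow_mul, mul_comm, pow_mul, Real.sq_sqrt hθ0]
  have step : ∀ k, ‖f R - 1‖ ≤
      gnsNorm f (star R) * ((β + γ) * τ + (∑ i, ‖a i‖) * √θ ^ (k + 1)) := fun k => by
    set T := 1 + ∑ j, freeIterate h (k + 1) j with hT
    set E := Y * T - 1 with hE
    have hfT : f T = 1 := by
      rw [hT, map_add, map_sum, h1, Finset.sum_eq_zero, add_zero]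
      exact fun i _ => map_headSpan hfree hS (hmem (k + 1) i)
    have e1 : R = T - R * E := by
      rw [hE, mul_sub, ← mul_assoc, hR]; simp
    have e2 : f R - 1 = -f (R * E) := by
      conv_lhs => rw [e1]
      rw [map_sub, hfT]; ring
    have e3 : E = (Y - (1 - ∑ i, a i)) * T +
        ∑ i, ((1 - a i) * (1 + h i) - 1) * (1 + ∑ j, freeIterate h k j - freeIterate h k i) -
        ∑ i, a i * (∑ j, (freeIterate h (k + 1) j - freeIterate h k j) -
          (freeIterate h (k + 1) i - freeIterate h k i)) := by
      rw [hE, sub_mul, hT, one_sub_sum_mul_freeIterate]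
      abel
    have b1 : gnsNorm f ((Y - (1 - ∑ i, a i)) * T) ≤ β * τ :=
      (gnsNorm_mul_le f _ _).trans (mul_le_mul hY (hN _) (gnsNorm_nonneg _ _) hβ0)
    have b2 : gnsNorm f (∑ i, ((1 - a i) * (1 + h i) - 1) *
        (1 + ∑ j, freeIterate h k j - freeIterate h k i)) ≤ γ * τ := by
      refine (gnsNorm_sum_le f _ _).trans ?_
      refine le_trans ?_ (mul_le_mul_of_nonneg_right hρ (Real.sqrt_nonneg _))
      rw [Finset.sum_mul]
      refine Finset.sum_le_sum fun i _ => (gnsNorm_mul_le f _ _).trans ?_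
      refine mul_le_mul_of_nonneg_left (le_trans ?_ (hN k)) (norm_nonneg _)
      simpa using gnsNorm_sub_head_le hfree hS (hmem k) 1 i
    have b3 : gnsNorm f (∑ i, a i * (∑ j, (freeIterate h (k + 1) j - freeIterate h k j) -
          (freeIterate h (k + 1) i - freeIterate h k i))) ≤ (∑ i, ‖a i‖) * √θ ^ (k + 1) := by
      refine (gnsNorm_sum_le f _ _).trans ?_
      rw [Finset.sum_mul]
      refine Finset.sum_le_sum fun i _ => (gnsNorm_mul_le f _ _).trans ?_
      refine mul_le_mul_of_nonneg_left (le_trans ?_ (hD k)) (norm_nonneg _)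
      simpa using gnsNorm_sub_head_le hfree hS
        (fun i => sub_mem (hmem (k + 1) i) (hmem k i)) 0 i
    have hEN : gnsNorm f E ≤ (β + γ) * τ + (∑ i, ‖a i‖) * √θ ^ (k + 1) := by
      rw [e3]
      refine (gnsNorm_sub_le f _ _).trans ?_
      have := gnsNorm_add_le f ((Y - (1 - ∑ i, a i)) * T)
        (∑ i, ((1 - a i) * (1 + h i) - 1) * (1 + ∑ j, freeIterate h k j - freeIterate h k i))
      linarith
    rw [e2, norm_neg]
    have := norm_map_star_mul_le f (star R) E
    rw [star_star] at this
    exact this.trans (mul_le_mul_of_nonneg_left hEN (gnsNorm_nonneg _ _))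
  have hlim : Tendsto (fun k : ℕ => gnsNorm f (star R) *
      ((β + γ) * τ + (∑ i, ‖a i‖) * √θ ^ (k + 1))) atTop
      (𝓝 (gnsNorm f (star R) * ((β + γ) * τ + (∑ i, ‖a i‖) * 0))) := by
    refine Tendsto.const_mul _ (Tendsto.const_add _ (Tendsto.const_mul _ ?_))
    refine (tendsto_pow_atTop_nhds_zero_of_lt_one (Real.sqrt_nonneg _) ?_).comp
      (tendsto_add_atTop_nat 1)
    rw [Real.sqrt_lt' one_pos]; simpa using hθ1
  rw [mul_zero, add_zero] at hlim
  exact ge_of_tendsto' hlim step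

end ApproximateInverse

section Resolvent

open scoped ComplexOrder

lemma im_add_inv {g : ℂ} (hg : g ≠ 0) : (g + g⁻¹).im * ‖g‖ ^ 2 = -g.im * (1 - ‖g‖ ^ 2) := by
  have : ‖g‖ ^ 2 ≠ 0 := by positivity
  rw [Complex.add_im, Complex.inv_im, Complex.normSq_eq_norm_sq]
  field_simp
  ring

lemma im_add_inv_mul_sq_le {g : ℂ} (hg : g ≠ 0) (hg1 : ‖g‖ < 1) :
    (g + g⁻¹).im * ‖g‖ ^ 2 ≤ 1 - ‖g‖ ^ 2 := by
  rw [im_add_inv hg]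
  have h1 : -g.im ≤ 1 := (neg_le_abs _).trans ((Complex.abs_im_le_norm g).trans hg1.le)
  have h2 : 0 ≤ 1 - ‖g‖ ^ 2 := by nlinarith [norm_nonneg g]
  nlinarith

variable {A : Type*} [CStarAlgebra A]

/-- Linear part of the free analogue of `g * (z - S)`. -/
def freeLin (g : ℂ) (s : ℝ) (x : A) : A := g • x - (g ^ 2 * (s : ℂ) ^ 2) • (1 : A)

/-- First terms of the centred inverse of `1 - freeLin g s x`. -/
def freeInv (g : ℂ) (s : ℝ) (x : A) : A := g • x + g ^ 2 • (x ^ 2 - ((s : ℂ) ^ 2) • (1 : A))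

lemma freeLin_freeInv (g : ℂ) (s : ℝ) (x : A) :
    (1 - freeLin g s x) * (1 + freeInv g s x) - 1 =
      -(g ^ 3 • x ^ 3) + (2 * g ^ 3 * (s : ℂ) ^ 2) • x +
        (g ^ 4 * (s : ℂ) ^ 2) • (x ^ 2 - ((s : ℂ) ^ 2) • (1 : A)) := by
  simp only [freeLin, freeInv, sub_mul, mul_add, mul_sub, smul_mul_assoc, mul_smul_comm,
    one_mul, mul_one, smul_sub, ← pow_succ', ← sq]
  module

lemma norm_freeLin_freeInv_le {g : ℂ} {s : ℝ} {x : A} (hg : ‖g‖ ≤ 1) (hx : ‖x‖ ≤ 1)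
    (hs : s ^ 2 ≤ ‖x‖ ^ 2) :
    ‖(1 - freeLin g s x) * (1 + freeInv g s x) - 1‖ ≤ 5 * ‖g‖ * ‖x‖ ^ 3 := by
  rw [freeLin_freeInv]
  have hs' : ‖(s : ℂ) ^ 2‖ = s ^ 2 := by
    rw [← Complex.ofReal_pow, Complex.norm_real, Real.norm_of_nonneg (sq_nonneg s)]
  have hκ := norm_nonneg x
  have hr := norm_nonneg g
  have b1 : ‖-(g ^ 3 • x ^ 3)‖ ≤ ‖g‖ ^ 3 * ‖x‖ ^ 3 := by
    rw [norm_neg, norm_smul, norm_pow]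
    gcongr
    exact norm_pow_le' x three_pos
  have b2 : ‖(2 * g ^ 3 * (s : ℂ) ^ 2) • x‖ ≤ 2 * ‖g‖ ^ 3 * ‖x‖ ^ 2 * ‖x‖ := by
    rw [norm_smul, norm_mul, norm_mul, norm_pow, hs', Complex.norm_ofNat]
    gcongr
  have b0 : ‖x ^ 2 - ((s : ℂ) ^ 2) • (1 : A)‖ ≤ ‖x‖ ^ 2 + ‖x‖ ^ 2 * 1 := by
    refine (norm_sub_le _ _).trans (add_le_add (norm_pow_le' x two_pos) ?_)
    rw [norm_smul, hs']
    exact mul_le_mul hs norm_one_le_one (norm_nonneg _) (by positivity)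
  have b3 : ‖(g ^ 4 * (s : ℂ) ^ 2) • (x ^ 2 - ((s : ℂ) ^ 2) • (1 : A))‖ ≤
      ‖g‖ ^ 4 * ‖x‖ ^ 2 * (‖x‖ ^ 2 + ‖x‖ ^ 2 * 1) := by
    rw [norm_smul, norm_mul, norm_pow, hs']
    gcongr
  refine norm_add₃_le.trans ?_
  have g3 : ‖g‖ ^ 3 ≤ ‖g‖ := by
    simpa using pow_le_pow_of_le_one hr hg (show 1 ≤ 3 by norm_num)
  have g4 : ‖g‖ ^ 4 ≤ ‖g‖ := by
    simpa using pow_le_pow_of_le_one hr hg (show 1 ≤ 4 by norm_num)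
  have x4 : ‖x‖ ^ 4 ≤ ‖x‖ ^ 3 := pow_le_pow_of_le_one hκ hx (by norm_num)
  calc _ ≤ ‖g‖ ^ 3 * ‖x‖ ^ 3 + 2 * ‖g‖ ^ 3 * ‖x‖ ^ 2 * ‖x‖ +
        ‖g‖ ^ 4 * ‖x‖ ^ 2 * (‖x‖ ^ 2 + ‖x‖ ^ 2 * 1) := by linarith
    _ = 3 * ‖g‖ ^ 3 * ‖x‖ ^ 3 + 2 * ‖g‖ ^ 4 * ‖x‖ ^ 4 := by ring
    _ ≤ 3 * ‖g‖ * ‖x‖ ^ 3 + 2 * ‖g‖ * ‖x‖ ^ 3 := by gcongr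
    _ = _ := by ring

lemma freeInv_mem (g : ℂ) (s : ℝ) (x : A) : freeInv g s x ∈ Algebra.adjoin ℂ {x} :=
  have hx := Algebra.self_mem_adjoin_singleton ℂ x
  add_mem (Subalgebra.smul_mem _ hx _) (Subalgebra.smul_mem _
    (sub_mem (pow_mem hx _) (Subalgebra.smul_mem _ (one_mem _) _)) _)

variable {I : Type*} [PartialOrder A] [StarOrderedRing A] {f : A →ₚ[ℂ] ℂ}

lemma map_freeInv (h1 : f 1 = 1) {g : ℂ} {s : ℝ} {x : A} (h0 : f x = 0)
    (h2 : f (x ^ 2) = ((s ^ 2 : ℝ) : ℂ)) : f (freeInv g s x) = 0 := by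
  simp [freeInv, h0, h2, h1]

lemma gnsNorm_freeInv_sq_le (h1 : f 1 = 1) {g : ℂ} {s : ℝ} {x : A} (hx : IsSelfAdjoint x)
    (h2 : f (x ^ 2) = ((s ^ 2 : ℝ) : ℂ)) (hg : ‖g‖ ≤ 1) (hx1 : ‖x‖ ≤ 1) :
    gnsNorm f (freeInv g s x) ^ 2 ≤ ‖g‖ ^ 2 * (s ^ 2 + 3 * ‖x‖ ^ 3) := by
  have hN := gnsNorm_sq_of_isSelfAdjoint hx h2
  have hs := variance_le_norm_sq h1 hx h2
  have hκ := norm_nonneg x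
  have hr := norm_nonneg g
  have hn := gnsNorm_nonneg f x
  have hnx : gnsNorm f x ≤ ‖x‖ := gnsNorm_le_norm f h1 x
  have b : gnsNorm f (x ^ 2 - ((s : ℂ) ^ 2) • (1 : A)) ≤ ‖x‖ ^ 2 := by
    have := (gnsNorm_sub_map_smul_one_le h1 (x ^ 2)).trans
      ((gnsNorm_le_norm f h1 _).trans (norm_pow_le' x two_pos))
    rwa [h2, Complex.ofReal_pow] at this
  have b' : gnsNorm f (freeInv g s x) ≤ ‖g‖ * gnsNorm f x + ‖g‖ ^ 2 * ‖x‖ ^ 2 := by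
    refine (gnsNorm_add_le f _ _).trans ?_
    rw [gnsNorm_smul, gnsNorm_smul, norm_pow]
    gcongr
  refine (pow_le_pow_left₀ (gnsNorm_nonneg _ _) b' 2).trans ?_
  have x4 : ‖x‖ ^ 4 ≤ ‖x‖ ^ 3 := pow_le_pow_of_le_one hκ hx1 (by norm_num)
  calc _ = ‖g‖ ^ 2 * (gnsNorm f x ^ 2 + 2 * ‖g‖ * gnsNorm f x * ‖x‖ ^ 2 +
        ‖g‖ ^ 2 * ‖x‖ ^ 4) := by ring
    _ ≤ ‖g‖ ^ 2 * (gnsNorm f x ^ 2 + 2 * 1 * ‖x‖ * ‖x‖ ^ 2 + 1 ^ 2 * ‖x‖ ^ 3) := by gcongr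
    _ = _ := by rw [hN]; ring

/-- The expectation of the resolvent of a perturbation `u` of the free sum `∑ X i` is close to the
Cauchy transform of the semicircle law. -/
lemma norm_map_resolvent_sub_le [Fintype I] {X : I → A} {σ : I → ℝ} (h1 : f 1 = 1)
    (hX : ∀ i, IsSelfAdjoint (X i))
    (hfree : IsFreeFamily f.toLinearMap fun i => Algebra.adjoin ℂ {X i})
    (h0 : ∀ i, f (X i) = 0) (h2 : ∀ i, f (X i ^ 2) = ((σ i ^ 2 : ℝ) : ℂ))
    (hB : ∑ i, σ i ^ 2 = 1) (hX1 : ∀ i, ‖X i‖ ≤ 1) {ε : ℝ} (hε : ∑ i, ‖X i‖ ^ 3 ≤ ε)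
    {u : A} (hu : ‖u - ∑ i, X i‖ ≤ 72 * ε) {g : ℂ} (hg0 : g ≠ 0) (hg : ‖g‖ < 1) {v : ℝ}
    (hv : (g + g⁻¹).im = v) (hv0 : 0 < v) (hεv : 6 * ε ≤ v) {R : A}
    (hR : R * ((g + g⁻¹) • (1 : A) - u) = 1) :
    ‖f R - g‖ ≤ gnsNorm f (star R) * (110 * ε / √v) := by
  have hε0 : 0 ≤ ε := (Finset.sum_nonneg fun i _ => by positivity).trans hε
  have hr : 0 < ‖g‖ := norm_pos_iff.2 hg0
  set θ := ‖g‖ ^ 2 * (1 + 3 * ε) with hθ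
  have hvr := im_add_inv_mul_sq_le hg0 hg
  rw [hv] at hvr
  have hθv : ‖g‖ ^ 2 * (v / 2) ≤ 1 - θ := by
    have : ‖g‖ ^ 2 * (6 * ε) ≤ ‖g‖ ^ 2 * v := by gcongr
    linarith
  have hθ1 : θ < 1 := by
    have : 0 < ‖g‖ ^ 2 * (v / 2) := by positivity
    linarith
  have hsum : ∑ i, gnsNorm f (freeInv g (σ i) (X i)) ^ 2 ≤ θ := by
    refine (Finset.sum_le_sum fun i _ =>
      gnsNorm_freeInv_sq_le h1 (hX i) (h2 i) hg.le (hX1 i)).trans ?_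
    rw [← Finset.mul_sum, Finset.sum_add_distrib, hB, ← Finset.mul_sum]
    rw [hθ]
    gcongr
  have hρ : ∑ i, ‖(1 - freeLin g (σ i) (X i)) * (1 + freeInv g (σ i) (X i)) - 1‖ ≤
      5 * ‖g‖ * ε := by
    refine (Finset.sum_le_sum fun i _ => norm_freeLin_freeInv_le hg.le (hX1 i)
      (variance_le_norm_sq h1 (hX i) (h2 i))).trans ?_
    rw [← Finset.mul_sum]
    gcongr
  have hY : ‖g • ((g + g⁻¹) • (1 : A) - u) - (1 - ∑ i, freeLin g (σ i) (X i))‖ ≤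
      ‖g‖ * (72 * ε) := by
    have e : g • ((g + g⁻¹) • (1 : A) - u) - (1 - ∑ i, freeLin g (σ i) (X i)) =
        -(g • (u - ∑ i, X i)) := by
      simp only [freeLin, Finset.sum_sub_distrib, ← Finset.smul_sum, ← Finset.sum_smul,
        ← Finset.mul_sum, ← Complex.ofReal_pow]
      rw [← Complex.ofReal_sum, hB, smul_sub, smul_smul, mul_add, mul_inv_cancel₀ hg0,
        Complex.ofReal_one]
      module
    rw [e, norm_neg, norm_smul]
    gcongr
  have hR' : (g⁻¹ • R) * (g • ((g + g⁻¹) • (1 : A) - u)) = 1 := by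
    rw [smul_mul_smul_comm, hR, inv_mul_cancel₀ hg0, one_smul]
  have key := norm_map_leftInverse_sub_one_le h1 hfree
    (fun i a ha => star_mem_adjoin_singleton (hX i) ha) (fun i => freeInv_mem _ _ _)
    (fun i => map_freeInv h1 (h0 i) (h2 i)) hsum hθ1 hR' hY hρ
  have e1 : f (g⁻¹ • R) - 1 = g⁻¹ * (f R - g) := by
    rw [map_smul, smul_eq_mul, mul_sub, inv_mul_cancel₀ hg0]
  rw [e1, star_smul, gnsNorm_smul, norm_mul, norm_star, mul_assoc] at key
  have key2 := le_of_mul_le_mul_left key (norm_pos_iff.2 (inv_ne_zero hg0))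
  refine key2.trans (mul_le_mul_of_nonneg_left ?_ (gnsNorm_nonneg _ _))
  have hτ : ‖g‖ * √(1 - θ)⁻¹ ≤ √2 / √v := by
    rw [← Real.sqrt_div zero_le_two]
    refine Real.le_sqrt_of_sq_le ?_
    rw [mul_pow, Real.sq_sqrt (inv_nonneg.2 (by linarith)), ← div_eq_mul_inv,
      div_le_div_iff₀ (by linarith) hv0]
    linarith
  have hs2 : √2 ≤ 10 / 7 := Real.sqrt_le_iff.2 ⟨by norm_num, by norm_num⟩
  calc _ = 77 * ε * (‖g‖ * √(1 - θ)⁻¹) := by ring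
    _ ≤ 77 * ε * (√2 / √v) := by gcongr
    _ ≤ 77 * ε * (10 / 7 / √v) := by gcongr
    _ = _ := by ring

end Resolvent

section Distribution

open scoped ComplexOrder

variable {A : Type*} [CStarAlgebra A] [PartialOrder A] [StarOrderedRing A] {f : A →ₚ[ℂ] ℂ}
  {u : A} {μ : Measure ℝ}

lemma integrable_pow_of_isDistribution (hf : ∀ x, f (star x * x) = 0 → x = 0)
    (hu : IsSelfAdjoint u) (hu0 : u ≠ 0) (hμ : IsDistribution f.toLinearMap u μ) (k : ℕ) :
    Integrable (fun t : ℝ => t ^ (2 * 2 ^ k)) μ := by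
  by_contra h
  have hm := hμ.2 (2 * 2 ^ k)
  rw [integral_undef h, Complex.ofReal_zero] at hm
  have e : u ^ (2 * 2 ^ k) = star (u ^ 2 ^ k) * u ^ 2 ^ k := by
    rw [star_pow, hu.star_eq, ← pow_add, two_mul]
  rw [e] at hm
  have h0 := hf _ hm
  have hn : ‖u ^ 2 ^ k‖ = ‖u‖ ^ 2 ^ k := by
    have := hu.nnnorm_pow_two_pow k
    simpa using congrArg NNReal.toReal this
  rw [h0, norm_zero] at hn
  exact hu0 (norm_eq_zero.1 (pow_eq_zero_iff (by positivity) |>.1 hn.symm))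

lemma measure_abs_gt_of_isDistribution (hf : ∀ x, f (star x * x) = 0 → x = 0) (h1 : f 1 = 1)
    (hu : IsSelfAdjoint u) (hu0 : u ≠ 0) (hμ : IsDistribution f.toLinearMap u μ) {M : ℝ}
    (hM : ‖u‖ ≤ M) : μ (Set.Icc (-M) M)ᶜ = 0 := by
  have := hμ.1
  have hM0 : 0 < M := (norm_pos_iff.2 hu0).trans_le hM
  have tail : ∀ δ > 0, μ {t | M + δ ≤ |t|} = 0 := by
    intro δ hδ
    have bound : ∀ k : ℕ, μ.real {t | M + δ ≤ |t|} ≤ (M / (M + δ)) ^ (2 * 2 ^ k) := fun k => by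
      have hint := integrable_pow_of_isDistribution hf hu hu0 hμ k
      have heven : Even (2 * 2 ^ k) := even_two_mul _
      have hmk := mul_meas_ge_le_integral_of_nonneg
        (ae_of_all _ fun t : ℝ => heven.pow_nonneg t) hint ((M + δ) ^ (2 * 2 ^ k))
      have hmom : ∫ t, t ^ (2 * 2 ^ k) ∂μ ≤ M ^ (2 * 2 ^ k) := by
        have e : f (u ^ (2 * 2 ^ k)) = ((∫ t, t ^ (2 * 2 ^ k) ∂μ : ℝ) : ℂ) := hμ.2 _
        have b := norm_map_le_norm f h1 (u ^ (2 * 2 ^ k))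
        rw [e, Complex.norm_real] at b
        refine (le_abs_self _).trans (b.trans ((norm_pow_le' u (by positivity)).trans ?_))
        gcongr
      have hsub : μ.real {t | M + δ ≤ |t|} ≤
          μ.real {t | (M + δ) ^ (2 * 2 ^ k) ≤ t ^ (2 * 2 ^ k)} := by
        refine measureReal_mono fun t ht => ?_
        rw [Set.mem_ofPred_eq] at ht ⊢
        rw [← heven.pow_abs t]
        gcongr
      rw [div_pow, le_div_iff₀ (by positivity)]
      calc _ ≤ μ.real {t | (M + δ) ^ (2 * 2 ^ k) ≤ t ^ (2 * 2 ^ k)} * (M + δ) ^ (2 * 2 ^ k) := by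
            gcongr
        _ ≤ _ := by linarith
    have hlim : Tendsto (fun k : ℕ => (M / (M + δ)) ^ (2 * 2 ^ k)) atTop (𝓝 0) := by
      refine (tendsto_pow_atTop_nhds_zero_of_lt_one (by positivity)
        ((div_lt_one (by linarith)).2 (by linarith))).comp ?_
      exact tendsto_atTop_mono (fun k => (Nat.lt_two_pow_self (n := k)).le.trans (by omega))
        tendsto_id
    have h0 : μ.real {t | M + δ ≤ |t|} ≤ 0 := ge_of_tendsto' hlim bound
    exact (measureReal_eq_zero_iff).1 (le_antisymm h0 measureReal_nonneg)
  have hsub : (Set.Icc (-M) M)ᶜ ⊆ ⋃ n : ℕ, {t : ℝ | M + 1 / (n + 1 : ℝ) ≤ |t|} := by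
    intro t ht
    rw [Set.mem_compl_iff, Set.mem_Icc, ← abs_le, not_le] at ht
    obtain ⟨n, hn⟩ := exists_nat_one_div_lt (sub_pos.2 ht)
    refine Set.mem_iUnion.2 ⟨n, ?_⟩
    rw [Set.mem_ofPred_eq]
    linarith
  exact measure_mono_null hsub (measure_iUnion_null fun n => tail _ (by positivity))

lemma integrable_of_measure_compl_Icc_eq_zero [IsProbabilityMeasure μ] {M : ℝ}
    (hμ : μ (Set.Icc (-M) M)ᶜ = 0) {w : ℝ → ℝ} (hw : Continuous w) : Integrable w μ := by
  obtain ⟨C, hC⟩ := isCompact_Icc.exists_bound_of_continuousOn (s := Set.Icc (-M) M) hw.continuousOn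
  refine Integrable.of_bound hw.aestronglyMeasurable C ?_
  have : ∀ᵐ t ∂μ, t ∈ Set.Icc (-M) M := by rw [ae_iff]; exact hμ
  filter_upwards [this] with t ht using hC t ht

/-- The analytic distribution computes the continuous functional calculus. -/
lemma map_cfc_eq_integral (h1 : f 1 = 1) (hu : IsSelfAdjoint u)
    (hμ : IsDistribution f.toLinearMap u μ) {M : ℝ} (hM : ‖u‖ ≤ M)
    (hsupp : μ (Set.Icc (-M) M)ᶜ = 0) {w : ℝ → ℝ} (hw : Continuous w) :
    f (cfc w u) = ((∫ t, w t ∂μ : ℝ) : ℂ) := by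
  have := hμ.1
  have hae : ∀ᵐ t ∂μ, t ∈ Set.Icc (-M) M := by rw [ae_iff]; exact hsupp
  have hpoly : ∀ p : Polynomial ℝ, f (Polynomial.aeval u p) = ((∫ t, p.eval t ∂μ : ℝ) : ℂ) := by
    intro p
    induction p using Polynomial.induction_on' with
    | add p q hp hq =>
      simp only [map_add, Polynomial.eval_add]
      rw [integral_add (integrable_of_measure_compl_Icc_eq_zero hsupp p.continuous)
        (integrable_of_measure_compl_Icc_eq_zero hsupp q.continuous), hp, hq, Complex.ofReal_add]
    | monomial n a =>
      have : f (u ^ n) = ((∫ t, t ^ n ∂μ : ℝ) : ℂ) := hμ.2 n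
      simp only [Polynomial.aeval_monomial, Polynomial.eval_monomial]
      rw [integral_const_mul, ← Algebra.smul_def, ← Complex.coe_smul, map_smul, this, smul_eq_mul,
        Complex.ofReal_mul]
  have hspec : ∀ t ∈ spectrum ℝ u, t ∈ Set.Icc (-M) M := fun t ht => by
    have h := norm_apply_le_norm_cfc (fun t : ℝ => t) u ht
    rw [cfc_id' ℝ u, Real.norm_eq_abs] at h
    exact abs_le.1 (h.trans hM)
  have close : ∀ δ > 0, ‖f (cfc w u) - ((∫ t, w t ∂μ : ℝ) : ℂ)‖ ≤ 2 * δ := by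
    intro δ hδ
    obtain ⟨p, hp⟩ := exists_polynomial_near_of_continuousOn (-M) M w hw.continuousOn δ hδ
    have b1 : ‖f (cfc w u) - f (Polynomial.aeval u p)‖ ≤ δ := by
      rw [← map_sub, ← cfc_polynomial p u, ← cfc_sub ..]
      refine (norm_map_le_norm f h1 _).trans (norm_cfc_le hδ.le fun t ht => ?_)
      rw [Real.norm_eq_abs, abs_sub_comm]
      exact (hp t (hspec t ht)).le
    have b2 : ‖((∫ t, p.eval t ∂μ : ℝ) : ℂ) - ((∫ t, w t ∂μ : ℝ) : ℂ)‖ ≤ δ := by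
      rw [← Complex.ofReal_sub, Complex.norm_real, ← integral_sub
        (integrable_of_measure_compl_Icc_eq_zero hsupp p.continuous)
        (integrable_of_measure_compl_Icc_eq_zero hsupp hw)]
      refine (norm_integral_le_of_norm_le_const (C := δ) ?_).trans (by simp)
      filter_upwards [hae] with t ht using (hp t ht).le
    rw [hpoly] at b1
    have := norm_add_le (f (cfc w u) - ((∫ t, p.eval t ∂μ : ℝ) : ℂ))
      (((∫ t, p.eval t ∂μ : ℝ) : ℂ) - ((∫ t, w t ∂μ : ℝ) : ℂ))
    rw [sub_add_sub_cancel] at this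
    linarith
  rw [← sub_eq_zero, ← norm_le_zero_iff]
  refine le_of_forall_pos_le_add fun δ hδ => ?_
  have := close (δ / 2) (by positivity)
  linarith

lemma inv_sub_ofReal_eq (z : ℂ) (t : ℝ) :
    (z - t)⁻¹ = (((z.re - t) * ((z.re - t) ^ 2 + z.im ^ 2)⁻¹ : ℝ) : ℂ) +
      Complex.I * ((-z.im * ((z.re - t) ^ 2 + z.im ^ 2)⁻¹ : ℝ) : ℂ) := by
  have hn : Complex.normSq (z - t) = (z.re - t) ^ 2 + z.im ^ 2 := by
    rw [Complex.normSq_apply]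
    simp only [Complex.sub_re, Complex.sub_im, Complex.ofReal_re, Complex.ofReal_im]
    ring
  rw [Complex.inv_def, hn]
  apply Complex.ext <;> simp

lemma cfc_add_I_smul_mul_eq_one (hu : IsSelfAdjoint u) {r s : ℝ → ℝ} (hr : Continuous r)
    (hs : Continuous s) {z : ℂ} (h1 : ∀ t, r t * (z.re - t) - s t * z.im = 1)
    (h2 : ∀ t, s t * (z.re - t) + r t * z.im = 0) :
    (cfc r u + Complex.I • cfc s u) * (z • (1 : A) - u) = 1 := by
  have hl : Continuous fun t : ℝ => z.re - t := by fun_prop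
  have el : cfc (fun t : ℝ => z.re - t) u = z.re • (1 : A) - u := by
    rw [cfc_sub (fun _ : ℝ => z.re) (fun t => t) u continuousOn_const continuousOn_id, cfc_id' ℝ u,
      cfc_const _ u, Algebra.algebraMap_eq_smul_one]
  have ez : z • (1 : A) - u = cfc (fun t => z.re - t) u + (Complex.I * z.im) • (1 : A) := by
    rw [el]
    conv_lhs => rw [← Complex.re_add_im z]
    simp only [← Complex.coe_smul]
    module
  have e1 : cfc r u * cfc (fun t => z.re - t) u = 1 + z.im • cfc s u := by
    rw [← cfc_mul r _ u hr.continuousOn hl.continuousOn, ← cfc_const_mul z.im s u hs.continuousOn,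
      ← cfc_const_one ℝ u, ← cfc_add u (fun _ : ℝ => (1 : ℝ)) (fun t => z.im * s t)
        continuousOn_const (hs.const_mul _).continuousOn]
    refine cfc_congr fun t _ => ?_
    have := h1 t
    linarith
  have e2 : cfc s u * cfc (fun t => z.re - t) u = -(z.im • cfc r u) := by
    rw [← cfc_mul s _ u hs.continuousOn hl.continuousOn, ← cfc_const_mul z.im r u hr.continuousOn,
      ← cfc_neg]
    refine cfc_congr fun t _ => ?_
    have := h2 t
    linarith
  rw [ez, add_mul, mul_add, mul_add, smul_mul_assoc, e1, smul_mul_assoc, e2]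
  simp only [mul_smul_comm, mul_one, smul_smul, ← Complex.coe_smul, smul_neg]
  have hI : Complex.I * (Complex.I * z.im) = -z.im := by
    rw [← mul_assoc, Complex.I_mul_I, neg_one_mul]
  rw [hI]
  module

lemma star_star_mul_star_cfc_add_I_smul (u : A) {r s d : ℝ → ℝ} (hr : Continuous r)
    (hs : Continuous s) (h : ∀ t, r t * r t + s t * s t = d t) :
    star (star (cfc r u + Complex.I • cfc s u)) * star (cfc r u + Complex.I • cfc s u) =
      cfc d u := by
  have hr' : star (cfc r u) = cfc r u := (cfc_predicate r u).star_eq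
  have hs' : star (cfc s u) = cfc s u := (cfc_predicate s u).star_eq
  have comm : cfc r u * cfc s u = cfc s u * cfc r u := cfc_commute_cfc r s u
  have ed : cfc d u = cfc r u * cfc r u + cfc s u * cfc s u := by
    rw [← cfc_mul r r u hr.continuousOn hr.continuousOn,
      ← cfc_mul s s u hs.continuousOn hs.continuousOn,
      ← cfc_add u (fun t => r t * r t) (fun t => s t * s t) (hr.mul hr).continuousOn
        (hs.mul hs).continuousOn]
    exact cfc_congr fun t _ => (h t).symm
  rw [ed, star_star, star_add, star_smul, hr', hs', Complex.star_def, Complex.conj_I]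
  have hI : Complex.I * -Complex.I = 1 := by rw [mul_neg, Complex.I_mul_I, neg_neg]
  rw [add_mul, mul_add, mul_add, smul_mul_smul_comm, hI, smul_mul_assoc, mul_smul_comm, comm]
  module

lemma exists_resolvent (h1 : f 1 = 1) (hu : IsSelfAdjoint u)
    (hμ : IsDistribution f.toLinearMap u μ) {M : ℝ} (hM : ‖u‖ ≤ M)
    (hsupp : μ (Set.Icc (-M) M)ᶜ = 0) {z : ℂ} (hz : 0 < z.im) :
    ∃ R : A, R * (z • (1 : A) - u) = 1 ∧ f R = cauchyG μ z ∧
      gnsNorm f (star R) ^ 2 = -(cauchyG μ z).im / z.im := by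
  have := hμ.1
  have hd0 : ∀ t : ℝ, (z.re - t) ^ 2 + z.im ^ 2 ≠ 0 := fun t => by positivity
  obtain ⟨d, hd⟩ : ∃ d : ℝ → ℝ, d = fun t => ((z.re - t) ^ 2 + z.im ^ 2)⁻¹ := ⟨_, rfl⟩
  obtain ⟨r, hr⟩ : ∃ r : ℝ → ℝ, r = fun t => (z.re - t) * d t := ⟨_, rfl⟩
  obtain ⟨s, hs⟩ : ∃ s : ℝ → ℝ, s = fun t => -z.im * d t := ⟨_, rfl⟩
  have hdc : Continuous d := by
    rw [hd]; exact Continuous.inv₀ (by fun_prop) hd0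
  have hrc : Continuous r := by rw [hr]; fun_prop
  have hsc : Continuous s := by rw [hs]; fun_prop
  have hdm : ∀ t, d t * ((z.re - t) ^ 2 + z.im ^ 2) = 1 := fun t => by
    rw [hd]; exact inv_mul_cancel₀ (hd0 t)
  have hG : cauchyG μ z = ((∫ t, r t ∂μ : ℝ) : ℂ) + Complex.I * ((∫ t, s t ∂μ : ℝ) : ℂ) := by
    rw [← integral_complex_ofReal, ← integral_complex_ofReal, ← integral_const_mul,
      ← integral_add]
    · refine integral_congr_ae (ae_of_all _ fun t => ?_)
      simp only [hr, hs, hd, inv_sub_ofReal_eq]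
    · exact (integrable_of_measure_compl_Icc_eq_zero hsupp hrc).ofReal
    · exact ((integrable_of_measure_compl_Icc_eq_zero hsupp hsc).ofReal).const_mul _
  refine ⟨cfc r u + Complex.I • cfc s u, ?_, ?_, ?_⟩
  · refine cfc_add_I_smul_mul_eq_one hu hrc hsc (fun t => ?_) fun t => ?_
    · rw [hr, hs]; linear_combination hdm t
    · rw [hr, hs]; ring
  · rw [map_add, map_smul, map_cfc_eq_integral h1 hu hμ hM hsupp hrc,
      map_cfc_eq_integral h1 hu hμ hM hsupp hsc, hG, smul_eq_mul]
  · have hsq : ((gnsNorm f (star (cfc r u + Complex.I • cfc s u)) ^ 2 : ℝ) : ℂ) =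
        ((∫ t, d t ∂μ : ℝ) : ℂ) := by
      rw [gnsNorm_sq, star_star_mul_star_cfc_add_I_smul u (d := d) hrc hsc fun t => ?_,
        map_cfc_eq_integral h1 hu hμ hM hsupp hdc]
      rw [hr, hs]; linear_combination d t * hdm t
    rw [Complex.ofReal_injective hsq, hG]
    have : ∫ t, s t ∂μ = -z.im * ∫ t, d t ∂μ := by rw [hs]; exact integral_const_mul _ _
    rw [this]
    simp
    field_simp

end Distribution

section VerticalIntegration

/-- Differentiating the Poisson-smoothed distribution function along `log` of the height. -/
lemma hasDerivAt_integral_arctan {μ : Measure ℝ} [IsProbabilityMeasure μ] (x s : ℝ) :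
    HasDerivAt (fun s => ∫ t, Real.arctan ((x - t) * Real.exp (-s)) ∂μ)
      (-(Real.exp s * (cauchyG μ ⟨x, Real.exp s⟩).re)) s := by
  have hd : ∀ t y : ℝ, HasDerivAt (fun s => Real.arctan ((x - t) * Real.exp (-s)))
      (1 / (1 + ((x - t) * Real.exp (-y)) ^ 2) * ((x - t) * (Real.exp (-y) * -1))) y := fun t y =>
    (((hasDerivAt_neg y).exp).const_mul (x - t)).arctan
  have hb : ∀ w : ℝ, |1 / (1 + w ^ 2) * w| ≤ 1 := fun w => by
    rw [one_div_mul_eq_div, abs_div, abs_of_pos (show (0:ℝ) < 1 + w ^ 2 by positivity),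
      div_le_one (by positivity), abs_le]
    constructor <;> nlinarith [sq_nonneg (w - 1), sq_nonneg (w + 1)]
  have key := (hasDerivAt_integral_of_dominated_loc_of_deriv_le (μ := μ) (bound := fun _ => 1)
    (F := fun s t => Real.arctan ((x - t) * Real.exp (-s)))
    (F' := fun y t => 1 / (1 + ((x - t) * Real.exp (-y)) ^ 2) *
      ((x - t) * (Real.exp (-y) * -1))) (x₀ := s) (s := Set.univ) univ_mem
    (Eventually.of_forall fun y => by fun_prop)
    (integrable_arctan_comp μ (by fun_prop)) (by fun_prop)
    (ae_of_all _ fun t y _ => by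
      have := hb ((x - t) * Real.exp (-y))
      rw [Real.norm_eq_abs, mul_neg_one, mul_neg, mul_neg, abs_neg]
      exact this)
    (integrable_const _) (ae_of_all _ fun t y _ => hd t y)).2
  refine key.congr_deriv (Eq.symm ?_)
  have hi : Integrable (fun t : ℝ => ((⟨x, Real.exp s⟩ : ℂ) - t)⁻¹) μ := by
    refine Integrable.of_bound (by fun_prop) (Real.exp s)⁻¹ (ae_of_all _ fun t => ?_)
    rw [norm_inv]
    gcongr
    have := Complex.abs_im_le_norm ((⟨x, Real.exp s⟩ : ℂ) - t)
    simpa [abs_of_pos (Real.exp_pos s)] using this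
  have hre : (cauchyG μ ⟨x, Real.exp s⟩).re = ∫ t, (((⟨x, Real.exp s⟩ : ℂ) - t)⁻¹).re ∂μ :=
    (integral_re hi).symm
  rw [hre, ← integral_const_mul, ← integral_neg]
  refine integral_congr_ae (ae_of_all _ fun t => ?_)
  have he := Real.exp_pos s
  have hp : (x - t) ^ 2 + Real.exp s ^ 2 ≠ 0 := by positivity
  have hq : 1 + ((x - t) * (Real.exp s)⁻¹) ^ 2 ≠ 0 := by positivity
  have hr : (((⟨x, Real.exp s⟩ : ℂ) - t)⁻¹).re = (x - t) * ((x - t) ^ 2 + Real.exp s ^ 2)⁻¹ := by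
    rw [inv_sub_ofReal_eq, Complex.add_re, Complex.ofReal_re, Complex.I_mul_re, Complex.ofReal_im,
      neg_zero, add_zero]
  simp only [hr, Real.exp_neg]
  field_simp
  ring

lemma abs_arctan_le (y : ℝ) : |Real.arctan y| ≤ |y| := by
  have h := Convex.norm_image_sub_le_of_norm_hasDerivWithin_le (𝕜 := ℝ) (C := 1)
    (f := Real.arctan) (s := Set.univ) (fun x _ => (Real.hasDerivAt_arctan x).hasDerivWithinAt)
    (fun x _ => by
      rw [Real.norm_eq_abs, abs_of_pos (by positivity), div_le_one (by positivity)]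
      nlinarith [sq_nonneg x]) convex_univ (Set.mem_univ 0) (Set.mem_univ y)
  simpa using h

/-- Comparison of two compactly supported laws with close Cauchy transforms. -/
lemma abs_integral_arctan_sub_le {μ ν : Measure ℝ} [IsProbabilityMeasure μ]
    [IsProbabilityMeasure ν] {K v V x M L : ℝ} (hv : 0 < v) (hV : v ≤ V)
    (hμ : μ (Set.Icc (-M) M)ᶜ = 0) (hν : ν (Set.Icc (-M) M)ᶜ = 0) (hx : |x| ≤ L)
    (hG : ∀ z : ℂ, v ≤ z.im → ‖cauchyG μ z - cauchyG ν z‖ ≤ K / z.im) :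
    |(∫ t, Real.arctan ((x - t) / v) ∂μ) - ∫ t, Real.arctan ((x - t) / v) ∂ν| ≤
      K * Real.log (V / v) + 2 * (L + M) / V := by
  have hV0 : 0 < V := hv.trans_le hV
  set D : ℝ → ℝ := fun s => (∫ t, Real.arctan ((x - t) * Real.exp (-s)) ∂μ) -
    ∫ t, Real.arctan ((x - t) * Real.exp (-s)) ∂ν with hD
  have hDe : ∀ {w : ℝ}, 0 < w → D (Real.log w) = (∫ t, Real.arctan ((x - t) / w) ∂μ) -
      ∫ t, Real.arctan ((x - t) / w) ∂ν := fun {w} hw => by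
    simp only [hD, Real.exp_neg, Real.exp_log hw, div_eq_mul_inv]
  have hder : ∀ s, HasDerivAt D (-(Real.exp s * (cauchyG μ ⟨x, Real.exp s⟩).re) -
      -(Real.exp s * (cauchyG ν ⟨x, Real.exp s⟩).re)) s := fun s =>
    (hasDerivAt_integral_arctan x s).sub (hasDerivAt_integral_arctan x s)
  have hlog : Real.log v ≤ Real.log V := Real.log_le_log hv hV
  have h1 : ‖D (Real.log V) - D (Real.log v)‖ ≤ K * ‖Real.log V - Real.log v‖ := by
    refine (convex_Icc (Real.log v) (Real.log V)).norm_image_sub_le_of_norm_hasDerivWithin_le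
      (fun s _ => (hder s).hasDerivWithinAt) (fun s hs => ?_) ⟨le_rfl, hlog⟩ ⟨hlog, le_rfl⟩
    have hvs : v ≤ Real.exp s := (Real.log_le_iff_le_exp hv).1 hs.1
    have h := (Complex.abs_re_le_norm _).trans (hG ⟨x, Real.exp s⟩ hvs)
    rw [le_div_iff₀ (Real.exp_pos s)] at h
    rw [neg_sub_neg, ← mul_sub, norm_mul, Real.norm_eq_abs, abs_of_pos (Real.exp_pos s),
      Real.norm_eq_abs, abs_sub_comm, mul_comm]
    simpa using h
  have h2 : ∀ ρ : Measure ℝ, IsProbabilityMeasure ρ → ρ (Set.Icc (-M) M)ᶜ = 0 →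
      ‖∫ t, Real.arctan ((x - t) / V) ∂ρ‖ ≤ (L + M) / V := fun ρ _ hρ => by
    refine (norm_integral_le_of_norm_le_const (C := (L + M) / V) ?_).trans (by simp)
    have : ∀ᵐ t ∂ρ, t ∈ Set.Icc (-M) M := by rw [ae_iff]; exact hρ
    filter_upwards [this] with t ht
    refine (abs_arctan_le _).trans ?_
    rw [abs_div, abs_of_pos hV0]
    gcongr
    exact (abs_sub _ _).trans (add_le_add hx (abs_le.2 ht))
  have hDV : |D (Real.log V)| ≤ 2 * (L + M) / V := by
    rw [hDe hV0]
    refine (abs_sub _ _).trans ((add_le_add (h2 μ ‹_› hμ) (h2 ν ‹_› hν)).trans ?_)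
    rw [← add_div, two_mul]
  rw [← hDe hv, Real.log_div hV0.ne' hv.ne']
  rw [Real.norm_eq_abs, Real.norm_eq_abs, abs_of_nonneg (sub_nonneg.2 hlog), abs_sub_comm] at h1
  have := abs_sub_abs_le_abs_sub (D (Real.log v)) (D (Real.log V))
  linarith

lemma cdf_eq_of_measure_compl_Icc_eq_zero {μ ν : Measure ℝ} [IsProbabilityMeasure μ]
    [IsProbabilityMeasure ν] {M x : ℝ} (hμ : μ (Set.Icc (-M) M)ᶜ = 0)
    (hν : ν (Set.Icc (-M) M)ᶜ = 0) (hx : M < |x|) : cdf μ x = cdf ν x := by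
  unfold cdf
  rcases lt_abs.1 hx with h | h
  · have : ∀ ρ : Measure ℝ, IsProbabilityMeasure ρ → ρ (Set.Icc (-M) M)ᶜ = 0 →
        ρ (Set.Iic x) = 1 := fun ρ _ hρ => by
      rw [← prob_compl_eq_zero_iff measurableSet_Iic]
      refine measure_mono_null (Set.compl_subset_compl.2 fun t ht => ?_) hρ
      exact ht.2.trans h.le
    rw [this μ ‹_› hμ, this ν ‹_› hν]
  · have : ∀ ρ : Measure ℝ, ρ (Set.Icc (-M) M)ᶜ = 0 → ρ (Set.Iic x) = 0 := fun ρ hρ => by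
      refine measure_mono_null (t := (Set.Icc (-M) M)ᶜ) (fun t ht => ?_) hρ
      intro ht'
      have h1 : t ≤ x := ht
      linarith [ht'.1]
    rw [this μ hμ, this ν hν]

end VerticalIntegration

section Estimate

open scoped ComplexOrder

variable {A : Type*} [CStarAlgebra A] [PartialOrder A] [StarOrderedRing A] {f : A →ₚ[ℂ] ℂ}
  {u : A} {μ : Measure ℝ} {I : Type*}

lemma norm_cauchyG_sub_cauchyG_semicircleLaw_le [Fintype I] {X : I → A} {σ : I → ℝ} (h1 : f 1 = 1)
    (hX : ∀ i, IsSelfAdjoint (X i))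
    (hfree : IsFreeFamily f.toLinearMap fun i => Algebra.adjoin ℂ {X i})
    (h0 : ∀ i, f (X i) = 0) (h2 : ∀ i, f (X i ^ 2) = ((σ i ^ 2 : ℝ) : ℂ))
    (hB : ∑ i, σ i ^ 2 = 1) (hX1 : ∀ i, ‖X i‖ ≤ 1) {ε : ℝ} (hε : ∑ i, ‖X i‖ ^ 3 ≤ ε)
    (hu : IsSelfAdjoint u) (huS : ‖u - ∑ i, X i‖ ≤ 72 * ε)
    (hμ : IsDistribution f.toLinearMap u μ) {M : ℝ} (hM : ‖u‖ ≤ M)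
    (hsupp : μ (Set.Icc (-M) M)ᶜ = 0) {z : ℂ} (hz0 : 0 < z.im) (hz : 220 * ε ≤ z.im) :
    ‖cauchyG μ z - cauchyG semicircleLaw z‖ ≤ 220 * ε / z.im := by
  have hε0 : 0 ≤ ε := (Finset.sum_nonneg fun i _ => by positivity).trans hε
  obtain ⟨g, hg0, hg, hgz⟩ := exists_add_inv_eq hz0.ne'
  obtain ⟨R, hR, hfR, hN⟩ := exists_resolvent h1 hu hμ hM hsupp hz0
  rw [cauchyG_semicircleLaw hz0.ne' hg0 hg hgz, ← hfR]
  have key := norm_map_resolvent_sub_le h1 hX hfree h0 h2 hB hX1 hε huS hg0 hg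
    (congrArg Complex.im hgz) hz0 (by linarith) (by rw [hgz]; exact hR)
  have hNnn := gnsNorm_nonneg f (star R)
  rw [← hfR] at hN
  set v := z.im
  set N := gnsNorm f (star R)
  have hs : 0 < √v := Real.sqrt_pos.2 hz0
  have hss : √v * √v = v := Real.mul_self_sqrt hz0.le
  have hm : (N * √v) ^ 2 = -(f R).im := by
    rw [mul_pow, hN, sq, hss]; field_simp
  have hq0 : 0 ≤ N * √v := by positivity
  have e : N * (110 * ε / √v) = N * √v * (110 * ε / v) := by
    have : 110 * ε / v = 110 * ε / √v / √v := by rw [div_div, hss]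
    rw [this]; field_simp
  rw [e] at key
  have hεv : 110 * ε / v ≤ 1 / 2 := by
    rw [div_le_iff₀ hz0]; linarith
  have hεv0 : 0 ≤ 110 * ε / v := by positivity
  have him : -(f R).im ≤ 1 + ‖f R - g‖ := by
    have a1 := (neg_le_abs _).trans (Complex.abs_im_le_norm (f R))
    have a2 := norm_add_le (f R - g) g
    rw [sub_add_cancel] at a2
    linarith
  have hq2 : N * √v ≤ 2 := by nlinarith
  calc _ ≤ _ := key
    _ ≤ 2 * (110 * ε / v) := by gcongr
    _ = _ := by ring

lemma kolDist_semicircleLaw_le [Fintype I] {X : I → A} {σ : I → ℝ} (h1 : f 1 = 1)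
    (hf : ∀ x, f (star x * x) = 0 → x = 0)
    (hX : ∀ i, IsSelfAdjoint (X i))
    (hfree : IsFreeFamily f.toLinearMap fun i => Algebra.adjoin ℂ {X i})
    (h0 : ∀ i, f (X i) = 0) (h2 : ∀ i, f (X i ^ 2) = ((σ i ^ 2 : ℝ) : ℂ))
    (hB : ∑ i, σ i ^ 2 = 1) (hX1 : ∀ i, ‖X i‖ ≤ 1) {ε : ℝ} (hε0 : 0 < ε) (hε1 : ε ≤ 1 / 220)
    (hε : ∑ i, ‖X i‖ ^ 3 ≤ ε)
    (hu : IsSelfAdjoint u) (hu0 : u ≠ 0) (huS : ‖u - ∑ i, X i‖ ≤ 72 * ε) (hM : ‖u‖ ≤ 12)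
    (hμ : IsDistribution f.toLinearMap u μ) :
    kolDist μ semicircleLaw ≤
      (440 + (48 + 882 * Real.tan (3 * Real.pi / 8))) * (ε * |Real.log ε|) := by
  have := hμ.1
  have hπ := Real.pi_pos
  set a := Real.tan (3 * Real.pi / 8) with ha
  have ha0 : 0 ≤ a := (Real.tan_pos_of_pos_of_lt_pi_div_two (by positivity) (by linarith)).le
  have hat : Real.arctan a = 3 * Real.pi / 8 := Real.arctan_tan (by linarith) (by linarith)
  have hsupp := measure_abs_gt_of_isDistribution hf h1 hu hu0 hμ hM
  have hsc : semicircleLaw (Set.Icc (-12) 12)ᶜ = 0 :=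
    measure_mono_null (Set.compl_subset_compl.2 (Set.Icc_subset_Icc (by norm_num) (by norm_num)))
      semicircleLaw_compl_Icc
  have hv : 0 < 220 * ε := by positivity
  have hvV : 220 * ε ≤ 1 / ε := by
    rw [le_div_iff₀ hε0]; nlinarith
  have hlogε : 1 ≤ -Real.log ε := by
    rw [le_neg, Real.log_le_iff_le_exp hε0]
    have : (1 : ℝ) / 220 ≤ Real.exp (-1) := by
      have := Real.exp_neg_one_gt_d9
      linarith
    linarith
  have hlog : Real.log (1 / ε / (220 * ε)) ≤ 2 * -Real.log ε := by
    rw [Real.log_div (by positivity) (by positivity), Real.log_mul (by norm_num) hε0.ne',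
      one_div, Real.log_inv]
    have := Real.log_nonneg (show (1 : ℝ) ≤ 220 by norm_num)
    linarith
  have key := kolDist_le_of_arctan (μ := μ) (ν := semicircleLaw) (v := 220 * ε) (a := a) (M := 12)
    (η := 220 * ε * (2 * -Real.log ε) + 2 * (12 + a + 12) * ε) hv ha0 hat
    (by have : 0 ≤ -Real.log ε := by linarith
        positivity)
    (fun x y => cdf_semicircleLaw_sub_le)
    (fun x => cdf_eq_of_measure_compl_Icc_eq_zero hsupp hsc) (fun x hx => by
      refine (abs_integral_arctan_sub_le (K := 220 * ε) (L := 12 + a) hv hvV hsupp hsc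
        (hx.trans ?_) fun z hz => norm_cauchyG_sub_cauchyG_semicircleLaw_le h1 hX hfree h0 h2 hB
          hX1 hε hu huS hμ hM hsupp (hv.trans_le hz) hz).trans ?_
      · have : a * (220 * ε) ≤ a * 1 := by gcongr; linarith
        linarith
      · rw [div_div_eq_mul_div, div_one]
        gcongr)
  refine key.trans ?_
  rw [abs_of_nonpos (by linarith : Real.log ε ≤ 0)]
  have : ε ≤ ε * -Real.log ε := le_mul_of_one_le_right hε0.le hlogε
  have h3 : (48 + 662 * a) * ε ≤ (48 + 662 * a) * (ε * -Real.log ε) := by gcongr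
  have h4 : 0 ≤ a * (ε * -Real.log ε) := by
    have : 0 ≤ -Real.log ε := by linarith
    positivity
  linarith

end Estimate

section Normalized

open scoped ComplexOrder

variable {A : Type*} [CStarAlgebra A] [PartialOrder A] [StarOrderedRing A]

lemma exists_inv_fourth_root {V : A} (hV : IsUnit V) (hV0 : 0 ≤ V) :
    ∃ W : A, 0 ≤ W ∧ W ^ 4 * V = 1 ∧ V * W ^ 4 = 1 := by
  have hp : IsStrictlyPositive V := hV.isStrictlyPositive hV0
  have hW : (0 : A) ≤ V ^ (-(1 / 4) : ℝ) := CFC.rpow_nonneg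
  have h4 : (V ^ (-(1 / 4) : ℝ)) ^ 4 = V ^ (-1 : ℝ) := by
    rw [← CFC.rpow_natCast _ 4 hW, CFC.rpow_rpow V _ _ (by norm_num) hp]
    norm_num
  have h1 := CFC.rpow_neg_mul_rpow (1 : ℝ) hp
  have h2 := CFC.rpow_mul_rpow_neg (1 : ℝ) hp
  rw [CFC.rpow_one V hV0] at h1 h2
  exact ⟨V ^ (-(1 / 4) : ℝ), hW, by rw [h4]; exact h1, by rw [h4]; exact h2⟩

variable {f : A →ₚ[ℂ] ℂ} {μ : Measure ℝ} {I : Type*} [Fintype I] {X : I → A} {σ : I → ℝ}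

lemma isUnit_sum_sq (hf : ∀ x, f (star x * x) = 0 → x = 0)
    (h1 : f 1 = 1) (hX : ∀ i, IsSelfAdjoint (X i))
    (hfree : IsFreeFamily f.toLinearMap fun i => Algebra.adjoin ℂ {X i})
    (h2 : ∀ i, f (X i ^ 2) = ((σ i ^ 2 : ℝ) : ℂ)) (hB : ∑ i, σ i ^ 2 = 1)
    (hL : ∑ i, ‖X i‖ ^ 4 < 1 / 16) : IsUnit (∑ i, X i ^ 2) := by
  have h := norm_sum_sq_sub_one_le hf h1 hX hfree h2 hB
  have hs : √(∑ i, ‖X i‖ ^ 4) < 1 / 4 := by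
    rw [Real.sqrt_lt' (by norm_num)]; linarith
  rw [norm_sub_rev] at h
  have := isUnit_one_sub_of_norm_lt_one (h.trans_lt (by linarith))
  rwa [sub_sub_cancel] at this

lemma norm_sum_ge_one (hX : ∀ i, IsSelfAdjoint (X i)) (h1 : f 1 = 1)
    (hfree : IsFreeFamily f.toLinearMap fun i => Algebra.adjoin ℂ {X i})
    (h0 : ∀ i, f (X i) = 0) (h2 : ∀ i, f (X i ^ 2) = ((σ i ^ 2 : ℝ) : ℂ))
    (hB : ∑ i, σ i ^ 2 = 1) : 1 ≤ ‖∑ i, X i‖ := by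
  have h := gnsNorm_sum_headSpan_sq (g := X) hfree
    (fun i a ha => star_mem_adjoin_singleton (hX i) ha)
    (fun i => mem_headSpan (Algebra.self_mem_adjoin_singleton ℂ _) (h0 i))
  simp only [gnsNorm_sq_of_isSelfAdjoint (hX _) (h2 _), hB] at h
  have hle := gnsNorm_le_norm f h1 (∑ i, X i)
  have : 1 = gnsNorm f (∑ i, X i) := by
    rw [← pow_left_inj₀ zero_le_one (gnsNorm_nonneg _ _) two_ne_zero, h, one_pow]
  rwa [← this] at hle

lemma kolDist_selfNormalized_le (hf : ∀ x, f (star x * x) = 0 → x = 0)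
    (h1 : f 1 = 1) (hX : ∀ i, IsSelfAdjoint (X i))
    (hfree : IsFreeFamily f.toLinearMap fun i => Algebra.adjoin ℂ {X i})
    (h0 : ∀ i, f (X i) = 0) (h2 : ∀ i, f (X i ^ 2) = ((σ i ^ 2 : ℝ) : ℂ))
    (hB : ∑ i, σ i ^ 2 = 1) {ε : ℝ} (hε0 : 0 < ε) (hε3 : ∑ i, ‖X i‖ ^ 3 ≤ ε)
    (hε4 : √(∑ i, ‖X i‖ ^ 4) ≤ ε) (hε1 : ε < Real.exp (-1)) {W : A} (hW : 0 ≤ W)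
    (hWV : W ^ 4 * ∑ i, X i ^ 2 = 1)
    (hμ : IsDistribution f.toLinearMap (W * (∑ i, X i) * W) μ) :
    kolDist μ semicircleLaw ≤
      (708 + 882 * Real.tan (3 * Real.pi / 8)) * (ε * |Real.log ε|) := by
  have := hμ.1
  have hπ := Real.pi_pos
  have ha0 : 0 < Real.tan (3 * Real.pi / 8) :=
    Real.tan_pos_of_pos_of_lt_pi_div_two (by positivity) (by linarith)
  have hlog : 1 ≤ |Real.log ε| := by
    rw [← Real.log_lt_iff_lt_exp hε0] at hε1
    exact (le_neg.1 hε1.le).trans (neg_le_abs _)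
  have hεl : ε ≤ ε * |Real.log ε| := le_mul_of_one_le_right hε0.le hlog
  have hal : 0 ≤ Real.tan (3 * Real.pi / 8) * (ε * |Real.log ε|) := by positivity
  rcases lt_or_ge (1 / 220) ε with h | h
  · refine (kolDist_le_one μ semicircleLaw).trans ?_
    linarith
  have hX1 : ∀ i, ‖X i‖ ≤ 1 := fun i => by
    have hL4 : ∑ i, ‖X i‖ ^ 4 ≤ 1 := by
      rw [Real.sqrt_le_left hε0.le] at hε4
      nlinarith
    have := (Finset.single_le_sum (f := fun i => ‖X i‖ ^ 4) (fun i _ => by positivity)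
      (Finset.mem_univ i)).trans hL4
    exact (pow_le_one_iff_of_nonneg (norm_nonneg _) (by norm_num)).1 this
  have hV := (norm_sum_sq_sub_one_le hf h1 hX hfree h2 hB).trans
    (mul_le_mul_of_nonneg_left hε4 (by norm_num : (0 : ℝ) ≤ 4))
  have hW1 := norm_inv_fourth_root_sub_one_le hW hWV (by linarith) hV
  have hS3 := norm_sum_le_three hf h1 hX hfree h0 h2 hB hX1
  have hUS := norm_conj_sub_le (by linarith) hW1 hS3
  have hS1 := norm_sum_ge_one hX h1 hfree h0 h2 hB
  have hsa : IsSelfAdjoint (W * (∑ i, X i) * W) :=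
    (isSelfAdjoint_sum _ fun i _ => hX i).conjugate_self (IsSelfAdjoint.of_nonneg hW)
  have key := kolDist_semicircleLaw_le h1 hf hX hfree h0 h2 hB hX1 hε0 h hε3 hsa
    (fun hU => by
      rw [hU, zero_sub, norm_neg] at hUS
      linarith) (hUS.trans (by linarith)) (by
      have := norm_le_norm_add_norm_sub' (W * (∑ i, X i) * W) (∑ i, X i)
      linarith) hμ
  refine key.trans ?_
  linarith

end Normalized

section Main

open scoped ComplexOrder

lemma IsFreeFamily.mono {A I : Type*} [Ring A] [Algebra ℂ A] {φ : A →ₗ[ℂ] ℂ}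
    {S T : I → Subalgebra ℂ A} (h : IsFreeFamily φ S) (hTS : ∀ i, T i ≤ S i) :
    IsFreeFamily φ T :=
  fun k idx hne x hx h0 => h k idx hne x (fun j => hTS _ (hx j)) h0

lemma IsFreeFamily.comp_injective {A I J : Type*} [Ring A] [Algebra ℂ A] {φ : A →ₗ[ℂ] ℂ}
    {S : I → Subalgebra ℂ A} (h : IsFreeFamily φ S) {e : J → I} (he : Function.Injective e) :
    IsFreeFamily φ fun j => S (e j) :=
  fun k idx hne x hx h0 => h k (fun j => e (idx j)) (fun j => he.ne (hne j)) x hx h0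

variable {A : Type*} [CStarAlgebra A] [PartialOrder A] [StarOrderedRing A]

lemma exists_positiveLinearMap {φ : A →ₗ[ℂ] ℂ} (h : IsState φ) :
    ∃ f : A →ₚ[ℂ] ℂ, f.toLinearMap = φ :=
  ⟨PositiveLinearMap.mk₀ φ fun x hx => by
    obtain ⟨b, rfl⟩ := CStarAlgebra.nonneg_iff_eq_star_mul_self.1 hx
    exact Complex.le_def.2 ⟨(h.2 b).1, (h.2 b).2.symm⟩, rfl⟩

lemma selfNormalized_of_cstarAlgebra {φ : A →ₗ[ℂ] ℂ} (hφ : IsState φ) (hf : IsFaithful φ)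
    {X : ℕ → A} {σ : ℕ → ℝ} (hX : ∀ i, IsSelfAdjoint (X i)) (hfree : AreFree φ X)
    (h0 : ∀ i, φ (X i) = 0) (h2 : ∀ i, φ (X i ^ 2) = ((σ i ^ 2 : ℝ) : ℂ)) {n : ℕ}
    (hB : 0 < ∑ i ∈ Finset.range n, σ i ^ 2) (hL : Lsn X σ 4 n < 1 / 16) :
    (IsUnit (∑ i ∈ Finset.range n, X i ^ 2) ∧
        (∃ W : A, 0 ≤ W ∧
          W ^ 4 * (∑ i ∈ Finset.range n, X i ^ 2) = 1 ∧
          (∑ i ∈ Finset.range n, X i ^ 2) * W ^ 4 = 1)) ∧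
      ∀ W : A, 0 ≤ W →
        W ^ 4 * (∑ i ∈ Finset.range n, X i ^ 2) = 1 →
        (∑ i ∈ Finset.range n, X i ^ 2) * W ^ 4 = 1 →
        IsSelfAdjoint (W * (∑ i ∈ Finset.range n, X i) * W) ∧
        (Lsn X σ 3 n < 1 / (2 * Real.exp 1) →
          ∀ μ : Measure ℝ,
            IsDistribution φ (W * (∑ i ∈ Finset.range n, X i) * W) μ →
            kolDist μ semicircleLaw ≤
              (708 + 882 * Real.tan (3 * Real.pi / 8)) *
                max (|Real.log (Lsn X σ 3 n)| * Lsn X σ 3 n)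
                (|Real.log (Lsn X σ 4 n)| * Real.sqrt (Lsn X σ 4 n))) := by
  obtain ⟨f, rfl⟩ := exists_positiveLinearMap hφ
  have h1 : f 1 = 1 := hφ.1
  obtain ⟨B, hBdef⟩ : ∃ B, B = √(∑ i ∈ Finset.range n, σ i ^ 2) := ⟨_, rfl⟩
  have hB0 : 0 < B := hBdef ▸ Real.sqrt_pos.2 hB
  have hBB : B ^ 2 = ∑ i ∈ Finset.range n, σ i ^ 2 := by rw [hBdef, Real.sq_sqrt hB.le]
  let Y : Fin n → A := fun i => B⁻¹ • X i
  let τ : Fin n → ℝ := fun i => B⁻¹ * σ i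
  have hYX : ∀ i, IsSelfAdjoint (Y i) := fun i => (IsSelfAdjoint.all _).smul (hX _)
  have hYfree : IsFreeFamily f.toLinearMap fun i => Algebra.adjoin ℂ {Y i} := by
    refine (hfree.comp_injective Fin.val_injective).mono fun i => ?_
    rw [Algebra.adjoin_le_iff, Set.singleton_subset_iff]
    show B⁻¹ • X i ∈ Algebra.adjoin ℂ {X i}
    rw [← Complex.coe_smul]
    exact Subalgebra.smul_mem _ (Algebra.self_mem_adjoin_singleton ℂ _) _
  have hY0 : ∀ i, f (Y i) = 0 := fun i => by
    have : f (X i) = 0 := h0 i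
    simp only [Y]
    rw [← Complex.coe_smul, map_smul, this, smul_zero]
  have hY2 : ∀ i, f (Y i ^ 2) = ((τ i ^ 2 : ℝ) : ℂ) := fun i => by
    have : f (X i ^ 2) = ((σ i ^ 2 : ℝ) : ℂ) := h2 i
    simp only [Y, τ]
    rw [smul_pow, ← Complex.coe_smul, map_smul, this, smul_eq_mul, mul_pow]
    push_cast
    rfl
  have hτ : ∑ i, τ i ^ 2 = 1 := by
    simp only [τ, mul_pow]
    rw [← Finset.mul_sum, ← Finset.sum_range (fun i => σ i ^ 2), ← hBB]
    field_simp
  have hLsn : ∀ k, Lsn X σ k n = ∑ i, ‖Y i‖ ^ k := fun k => by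
    simp only [Lsn, Y, norm_smul, mul_pow]
    rw [← Finset.mul_sum, ← Finset.sum_range (fun i => ‖X i‖ ^ k), ← hBdef, norm_inv,
      Real.norm_of_nonneg hB0.le, inv_pow, div_eq_inv_mul]
  have hV : ∑ i, Y i ^ 2 = (B⁻¹ ^ 2) • ∑ i ∈ Finset.range n, X i ^ 2 := by
    simp only [Y, smul_pow]
    rw [← Finset.smul_sum, ← Finset.sum_range (fun i => X i ^ 2)]
  have hS : ∑ i, Y i = B⁻¹ • ∑ i ∈ Finset.range n, X i := by
    simp only [Y]
    rw [← Finset.smul_sum, ← Finset.sum_range]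
  have hfa : ∀ x, f (star x * x) = 0 → x = 0 := hf
  have hunit : IsUnit (∑ i ∈ Finset.range n, X i ^ 2) := by
    have := isUnit_sum_sq hfa h1 hYX hYfree hY2 hτ (hLsn 4 ▸ hL)
    rw [hV] at this
    exact (isUnit_smul_iff (Units.mk0 (B⁻¹ ^ 2) (by positivity)) _).1 this
  have hpos : 0 ≤ ∑ i ∈ Finset.range n, X i ^ 2 :=
    Finset.sum_nonneg fun i _ => (hX i).sq_nonneg
  refine ⟨⟨hunit, exists_inv_fourth_root hunit hpos⟩, fun W hW hWV _ => ⟨?_, fun hL3 μ hμ => ?_⟩⟩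
  · exact (isSelfAdjoint_sum _ fun i _ => hX i).conjugate_self (IsSelfAdjoint.of_nonneg hW)
  have hYne : ∃ i, 0 < ‖Y i‖ := by
    by_contra! h
    have : ∑ i, τ i ^ 2 ≤ ∑ i : Fin n, (0 : ℝ) := Finset.sum_le_sum fun i _ => by
      have e := variance_le_norm_sq h1 (hYX i) (hY2 i)
      rwa [le_antisymm (h i) (norm_nonneg _), zero_pow two_ne_zero] at e
    rw [hτ, Finset.sum_const_zero] at this
    linarith
  have hpk : ∀ k, 0 < Lsn X σ k n := fun k => by
    obtain ⟨i, hi⟩ := hYne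
    rw [hLsn]
    exact Finset.sum_pos' (fun i _ => by positivity) ⟨i, Finset.mem_univ _, by positivity⟩
  have hW' : (0 : A) ≤ √B • W := smul_nonneg (Real.sqrt_nonneg _) hW
  have hsB : √B ^ 2 = B := Real.sq_sqrt hB0.le
  have hWV' : (√B • W) ^ 4 * ∑ i, Y i ^ 2 = 1 := by
    rw [hV, smul_pow, smul_mul_smul_comm, hWV, show √B ^ 4 = (√B ^ 2) ^ 2 by ring, hsB, ← mul_pow,
      mul_inv_cancel₀ hB0.ne', one_pow, one_smul]
  have hU : (√B • W) * (∑ i, Y i) * (√B • W) = W * (∑ i ∈ Finset.range n, X i) * W := by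
    rw [hS, smul_mul_smul_comm, smul_mul_smul_comm,
      show √B * B⁻¹ * √B = 1 by
        rw [mul_right_comm, ← sq, hsB, mul_inv_cancel₀ hB0.ne'], one_smul]
  rw [← hU] at hμ
  have he : Real.exp (-1) = 1 / Real.exp 1 := by rw [Real.exp_neg, one_div]
  have hs4 : √(Lsn X σ 4 n) < 1 / 4 := by
    rw [Real.sqrt_lt' (by norm_num)]; linarith
  have hε1 : max (Lsn X σ 3 n) √(Lsn X σ 4 n) < Real.exp (-1) := by
    refine max_lt (hL3.trans_le ?_) (hs4.trans ?_)
    · rw [he]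
      have := Real.exp_pos 1
      gcongr
      linarith
    · have := Real.exp_neg_one_gt_d9
      linarith
  have key := kolDist_selfNormalized_le hfa h1 hYX hYfree hY0 hY2 hτ
    (ε := max (Lsn X σ 3 n) √(Lsn X σ 4 n)) (lt_max_of_lt_left (hpk 3))
    (by rw [← hLsn]; exact le_max_left _ _) (by rw [← hLsn]; exact le_max_right _ _) hε1
    hW' hWV' hμ
  have hπ := Real.pi_pos
  have ha0 : 0 < Real.tan (3 * Real.pi / 8) :=
    Real.tan_pos_of_pos_of_lt_pi_div_two (by positivity) (by linarith)
  refine key.trans (mul_le_mul_of_nonneg_left ?_ (by positivity))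
  rcases max_choice (Lsn X σ 3 n) √(Lsn X σ 4 n) with h | h <;> rw [h]
  · exact (mul_comm _ _).le.trans (le_max_left _ _)
  · refine le_trans ?_ (le_max_right _ _)
    rw [mul_comm, Real.log_sqrt (hpk 4).le, abs_div, abs_two]
    gcongr
    exact half_le_self (abs_nonneg _)

end Main

/-- **Theorem 1.1** (bounded self-normalized sums, non-identically distributed case).
If `L_{S,4n} < 1/16` then `V_n² = ∑ X_i²` is invertible, so that
`U_n = V_n^{-1/2} S_n V_n^{-1/2}` (written below as `W * S_n * W` where `W ≥ 0` is the
inverse fourth root of `V_n²`) is well-defined and self-adjoint; and there is an absolute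
constant `C > 0` such that if moreover `L_{S,3n} < 1/(2e)` then the analytic distribution
`μ_n` of `U_n` satisfies
`Δ(μ_n, ω) ≤ C · max (|log L_{S,3n}| · L_{S,3n}) (|log L_{S,4n}| · L_{S,4n}^{1/2})`. -/
theorem stmt_0 :
    ∃ C : ℝ, 0 < C ∧
    ∀ (A : Type) [NormedRing A] [StarRing A] [CStarRing A] [NormedAlgebra ℂ A]
      [CompleteSpace A] [StarModule ℂ A] [PartialOrder A] [StarOrderedRing A]
      (φ : A →ₗ[ℂ] ℂ), IsState φ → IsTracial φ → IsFaithful φ →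
    ∀ (X : ℕ → A) (σ : ℕ → ℝ),
      (∀ i, IsSelfAdjoint (X i)) → AreFree φ X →
      (∀ i, φ (X i) = 0) → (∀ i, φ (X i ^ 2) = ((σ i ^ 2 : ℝ) : ℂ)) →
    ∀ n : ℕ, 0 < ∑ i ∈ Finset.range n, σ i ^ 2 →
      Lsn X σ 4 n < 1 / 16 →
      (IsUnit (∑ i ∈ Finset.range n, X i ^ 2) ∧
        (∃ W : A, 0 ≤ W ∧
          W ^ 4 * (∑ i ∈ Finset.range n, X i ^ 2) = 1 ∧
          (∑ i ∈ Finset.range n, X i ^ 2) * W ^ 4 = 1)) ∧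
      ∀ W : A, 0 ≤ W →
        W ^ 4 * (∑ i ∈ Finset.range n, X i ^ 2) = 1 →
        (∑ i ∈ Finset.range n, X i ^ 2) * W ^ 4 = 1 →
        IsSelfAdjoint (W * (∑ i ∈ Finset.range n, X i) * W) ∧
        (Lsn X σ 3 n < 1 / (2 * Real.exp 1) →
          ∀ μ : Measure ℝ,
            IsDistribution φ (W * (∑ i ∈ Finset.range n, X i) * W) μ →
            kolDist μ semicircleLaw ≤
              C * max (|Real.log (Lsn X σ 3 n)| * Lsn X σ 3 n)
                (|Real.log (Lsn X σ 4 n)| * Real.sqrt (Lsn X σ 4 n))) := by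
  have hπ := Real.pi_pos
  have ha : 0 < Real.tan (3 * Real.pi / 8) :=
    Real.tan_pos_of_pos_of_lt_pi_div_two (by positivity) (by linarith)
  refine ⟨708 + 882 * Real.tan (3 * Real.pi / 8), by positivity, ?_⟩
  intro A _ _ _ _ _ _ _ _ φ hφ _ hf X σ hX hfree h0 h2 n hB hL
  let : CStarAlgebra A := {}
  exact selfNormalized_of_cstarAlgebra hφ hf hX hfree h0 h2 hB hL
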